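/- Let M = {c ∈ ℂ : the orbit of 0 under f_c is bounded} (the Mandelbrot set) and let P = {c ∈ ℂ : f_c has a parabolic periodic point} (the parabolic parameters). For every c ∈ M the filled Julia set K_c is a nonempty compact subset of ℂ, and the map c ↦ K_c, viewed as a map from M ∖ P to the space of nonempty compact subsets of ℂ equipped with the Hausdorff metric, is continuous at every point of M ∖ P. -/

import Mathlib

open Filter Metric Topology

noncomputable section

/-- The quadratic polynomial `f_c(z) = z² + c`. -/
def f (c : ℂ) : ℂ → ℂ := fun z => z ^ 2 + c

/-- The filled Julia set `K_c`: points with bounded forward orbit. -/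
def K (c : ℂ) : Set ℂ := {z : ℂ | Bornology.IsBounded (Set.range fun n => (f c)^[n] z)}

/-- The Mandelbrot set: parameters `c` for which the orbit of `0` under `f_c` is bounded. -/
def M : Set ℂ := {c : ℂ | Bornology.IsBounded (Set.range fun n => (f c)^[n] 0)}

/-- A complex number is a root of unity. -/
def IsRootOfUnity (u : ℂ) : Prop := ∃ n : ℕ, 1 ≤ n ∧ u ^ n = 1

/-- The set of parabolic parameters: `f_c` has a periodic point whose multiplier is a
root of unity. -/
def P : Set ℂ :=
  {c : ℂ | ∃ m : ℕ, 1 ≤ m ∧ ∃ ζ : ℂ, (f c)^[m] ζ = ζ ∧ IsRootOfUnity (deriv ((f c)^[m]) ζ)}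

/-! ### Basic properties of the quadratic family -/

theorem continuous_f_uncurry : Continuous fun p : ℂ × ℂ => f p.1 p.2 := by
  unfold f; fun_prop

theorem continuous_iterate_f_uncurry (n : ℕ) :
    Continuous fun p : ℂ × ℂ => (f p.1)^[n] p.2 := by
  induction n with
  | zero => simpa using continuous_snd
  | succ n ih =>
    simp only [Function.iterate_succ_apply']
    exact continuous_f_uncurry.comp (continuous_fst.prodMk ih)

theorem differentiable_f (c : ℂ) : Differentiable ℂ (f c) := by
  unfold f; fun_prop

theorem differentiable_iterate_f (c : ℂ) (n : ℕ) : Differentiable ℂ (f c)^[n] :=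
  (differentiable_f c).iterate n

theorem continuous_iterate_f (c : ℂ) (n : ℕ) : Continuous (f c)^[n] :=
  (differentiable_iterate_f c n).continuous

theorem f_neg (c z : ℂ) : f c (-z) = f c z := by simp [f]

/-- The escape radius. -/
def escapeRadius (c : ℂ) : ℝ := max 4 ‖c‖

theorem four_le_escapeRadius (c : ℂ) : 4 ≤ escapeRadius c := le_max_left _ _

theorem norm_le_escapeRadius (c : ℂ) : ‖c‖ ≤ escapeRadius c := le_max_right _ _

theorem sq_div_two_le_norm_f {c z : ℂ} (h : escapeRadius c ≤ ‖z‖) : ‖z‖ ^ 2 / 2 ≤ ‖f c z‖ := by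
  have h4 := (four_le_escapeRadius c).trans h
  have hc := (norm_le_escapeRadius c).trans h
  have : ‖z ^ 2‖ - ‖c‖ ≤ ‖z ^ 2 + c‖ := by
    have := norm_sub_le (z ^ 2 + c) c
    simp only [add_sub_cancel_right] at this
    linarith
  rw [norm_pow] at this
  simp only [f]
  nlinarith

theorem two_mul_le_norm_f {c z : ℂ} (h : escapeRadius c ≤ ‖z‖) : 2 * ‖z‖ ≤ ‖f c z‖ := by
  have := sq_div_two_le_norm_f h
  have h4 := (four_le_escapeRadius c).trans h
  nlinarith

theorem escapeRadius_le_norm_f {c z : ℂ} (h : escapeRadius c ≤ ‖z‖) :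
    escapeRadius c ≤ ‖f c z‖ := by
  have := two_mul_le_norm_f h
  have := norm_nonneg z
  linarith

theorem escapeRadius_le_norm_iterate_f {c z : ℂ} (h : escapeRadius c ≤ ‖z‖) (n : ℕ) :
    escapeRadius c ≤ ‖(f c)^[n] z‖ := by
  induction n with
  | zero => simpa
  | succ n ih => rw [Function.iterate_succ_apply']; exact escapeRadius_le_norm_f ih

/-- Doubly exponential escape. -/
theorem log_iterate_f_ge {c z : ℂ} (h : escapeRadius c ≤ ‖z‖) (n : ℕ) :
    2 ^ n * (Real.log ‖z‖ - Real.log 2) + Real.log 2 ≤ Real.log ‖(f c)^[n] z‖ := by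
  induction n with
  | zero => simp
  | succ n ih =>
    rw [Function.iterate_succ_apply']
    set y := (f c)^[n] z
    have hy : escapeRadius c ≤ ‖y‖ := escapeRadius_le_norm_iterate_f h n
    have h4 : 4 ≤ ‖y‖ := (four_le_escapeRadius c).trans hy
    have h1 : Real.log (‖y‖ ^ 2 / 2) ≤ Real.log ‖f c y‖ :=
      Real.log_le_log (by positivity) (sq_div_two_le_norm_f hy)
    rw [Real.log_div (by positivity) (by norm_num), Real.log_pow] at h1
    push_cast at h1
    rw [pow_succ]
    linarith

theorem norm_iterate_f_le (c z : ℂ) {R : ℝ} (hR : 1 ≤ R) (hc : ‖c‖ ≤ R) (hz : ‖z‖ ≤ R) (n : ℕ) :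
    ‖(f c)^[n] z‖ ≤ (2 * R) ^ (2 ^ n) := by
  have key : ∀ n, 2 * ‖(f c)^[n] z‖ ≤ (2 * R) ^ (2 ^ n) ∧ 2 * R ≤ (2 * R) ^ (2 ^ n) := by
    intro n
    induction n with
    | zero => simp; linarith
    | succ n ih =>
      rw [Function.iterate_succ_apply', pow_succ, pow_mul]
      set A := (2 * R) ^ (2 ^ n)
      have : ‖f c ((f c)^[n] z)‖ ≤ ‖(f c)^[n] z‖ ^ 2 + ‖c‖ := by
        simp only [f]; refine (norm_add_le _ _).trans ?_; rw [norm_pow]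
      have := norm_nonneg ((f c)^[n] z)
      constructor <;> nlinarith
  have := (key n).1
  have := norm_nonneg ((f c)^[n] z)
  linarith

theorem mem_K_iff_isBounded {c z : ℂ} :
    z ∈ K c ↔ Bornology.IsBounded (Set.range fun n => (f c)^[n] z) := by
  simp [K]

theorem mem_K_iff {c z : ℂ} : z ∈ K c ↔ ∀ n, ‖(f c)^[n] z‖ ≤ escapeRadius c := by
  constructor
  · intro h n
    by_contra! hn
    obtain ⟨B, hB⟩ := isBounded_iff_forall_norm_le.1 (mem_K_iff_isBounded.1 h)
    have h4 := four_le_escapeRadius c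
    have key : ∀ k, ((2:ℝ) ^ k) * 4 ≤ ‖(f c)^[n + k] z‖ := by
      intro k
      induction k with
      | zero => simp; linarith
      | succ k ih =>
        have h2 : escapeRadius c ≤ ‖(f c)^[n + k] z‖ := by
          rw [add_comm, Function.iterate_add_apply]
          exact escapeRadius_le_norm_iterate_f hn.le k
        have := two_mul_le_norm_f h2
        rw [← add_assoc, Function.iterate_succ_apply', pow_succ]
        linarith
    obtain ⟨k, hk⟩ := pow_unbounded_of_one_lt B (one_lt_two)
    have h1 := key k
    have h2 := hB _ (Set.mem_range_self (n + k))
    have : (0:ℝ) < 2 ^ k := by positivity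
    linarith
  · intro h
    refine mem_K_iff_isBounded.2 <| isBounded_iff_forall_norm_le.2 ⟨escapeRadius c, ?_⟩
    rintro _ ⟨n, rfl⟩
    exact h n

theorem norm_le_of_mem_K {c z : ℂ} (h : z ∈ K c) : ‖z‖ ≤ escapeRadius c := mem_K_iff.1 h 0

theorem f_mem_K_iff {c z : ℂ} : f c z ∈ K c ↔ z ∈ K c := by
  constructor
  · intro h
    rw [mem_K_iff] at h
    refine mem_K_iff_isBounded.2 <| isBounded_iff_forall_norm_le.2 ⟨max ‖z‖ (escapeRadius c), ?_⟩
    rintro _ ⟨n, rfl⟩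
    cases n with
    | zero => simp
    | succ n => exact (h n).trans (le_max_right _ _)
  · intro h
    rw [mem_K_iff] at h ⊢
    exact fun n => h (n + 1)

theorem iterate_f_mem_K_iff {c z : ℂ} (n : ℕ) : (f c)^[n] z ∈ K c ↔ z ∈ K c := by
  induction n with
  | zero => simp
  | succ n ih => rw [Function.iterate_succ_apply', f_mem_K_iff, ih]

theorem isClosed_K (c : ℂ) : IsClosed (K c) := by
  have : K c = ⋂ n, {z | ‖(f c)^[n] z‖ ≤ escapeRadius c} := by
    ext z; simp [mem_K_iff]
  rw [this]
  exact isClosed_iInter fun n => isClosed_le (continuous_iterate_f c n).norm continuous_const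

theorem isBounded_K (c : ℂ) : Bornology.IsBounded (K c) :=
  isBounded_iff_forall_norm_le.2 ⟨_, fun _ h => norm_le_of_mem_K h⟩

theorem isCompact_K (c : ℂ) : IsCompact (K c) :=
  isCompact_of_isClosed_isBounded (isClosed_K c) (isBounded_K c)

theorem zero_mem_K {c : ℂ} (h : c ∈ M) : (0 : ℂ) ∈ K c := by
  simpa [K, M] using h

theorem neg_mem_K_iff {c z : ℂ} : -z ∈ K c ↔ z ∈ K c := by
  rw [← f_mem_K_iff, f_neg, f_mem_K_iff]

theorem exists_iterate_large_of_notMem_K {c z : ℂ} (h : z ∉ K c) :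
    ∃ n, escapeRadius c < ‖(f c)^[n] z‖ := by
  simpa [mem_K_iff] using h

theorem isOpenMap_f (c : ℂ) : IsOpenMap (f c) := by
  have h : IsOpenMap fun z : ℂ => z ^ 2 := (Complex.isOpenQuotientMap_pow 2).isOpenMap
  exact (isOpenMap_add_right c).comp h

theorem isOpenMap_iterate_f (c : ℂ) (n : ℕ) : IsOpenMap (f c)^[n] := by
  induction n with
  | zero => exact IsOpenMap.id
  | succ n ih => rw [Function.iterate_succ']; exact (isOpenMap_f c).comp ih

theorem f_mem_interior_K {c z : ℂ} (h : z ∈ interior (K c)) : f c z ∈ interior (K c) := by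
  have : f c '' interior (K c) ⊆ interior (K c) := by
    refine interior_maximal ?_ (isOpenMap_f c _ isOpen_interior)
    rintro _ ⟨y, hy, rfl⟩
    exact f_mem_K_iff.2 (interior_subset hy)
  exact this ⟨z, h, rfl⟩

theorem iterate_f_mem_interior_K {c z : ℂ} (h : z ∈ interior (K c)) (n : ℕ) :
    (f c)^[n] z ∈ interior (K c) := by
  induction n with
  | zero => simpa
  | succ n ih => rw [Function.iterate_succ_apply']; exact f_mem_interior_K ih

/-! ### Harnack's inequality for `log ‖g‖` -/

theorem exists_exp_eq_on_ball {g : ℂ → ℂ} {z₀ : ℂ} {r : ℝ}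
    (hg : DifferentiableOn ℂ g (ball z₀ r)) (h0 : ∀ z ∈ ball z₀ r, g z ≠ 0) :
    ∃ h : ℂ → ℂ, DifferentiableOn ℂ h (ball z₀ r) ∧ ∀ z ∈ ball z₀ r, Complex.exp (h z) = g z := by
  rcases le_or_gt r 0 with hr | hr
  · exact ⟨0, by simp [ball_eq_empty.2 hr], by simp [ball_eq_empty.2 hr]⟩
  have hd : DifferentiableOn ℂ (fun z => deriv g z / g z) (ball z₀ r) :=
    (hg.deriv isOpen_ball).div hg h0
  obtain ⟨H, hH⟩ := hd.isExactOn_ball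
  have hz₀ : z₀ ∈ ball z₀ r := mem_ball_self hr
  refine ⟨fun z => H z - H z₀ + Complex.log (g z₀), ?_, ?_⟩
  · exact ((show DifferentiableOn ℂ H (ball z₀ r) from
      fun z hz => (hH z hz).differentiableAt.differentiableWithinAt).sub_const _).add_const _
  · have hconst : ∀ z ∈ ball z₀ r, g z * Complex.exp (-H z) = g z₀ * Complex.exp (-H z₀) := by
      intro z hz
      refine (convex_ball z₀ r).is_const_of_fderivWithin_eq_zero (𝕜 := ℂ)
        (f := fun z => g z * Complex.exp (-H z)) ?_ ?_ hz hz₀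
      · intro w hw
        exact ((hg w hw).mul (hH w hw).differentiableAt.differentiableWithinAt.neg.cexp)
      · intro w hw
        have hgw := (hg.differentiableAt (isOpen_ball.mem_nhds hw)).hasDerivAt
        have : HasDerivAt (fun z => g z * Complex.exp (-H z)) 0 w := by
          refine (hgw.mul (hH w hw).neg.cexp).congr_deriv ?_
          field_simp [h0 w hw]
          ring
        rw [fderivWithin_of_isOpen isOpen_ball hw]
        rw [this.hasFDerivAt.fderiv]; ext; simp
    intro z hz
    have := hconst z hz
    rw [Complex.exp_neg, Complex.exp_neg] at this
    have e1 := Complex.exp_ne_zero (H z)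
    have e2 := Complex.exp_ne_zero (H z₀)
    rw [Complex.exp_add, Complex.exp_sub, Complex.exp_log (h0 _ hz₀)]
    field_simp at this ⊢
    linear_combination -this

/-- Harnack's inequality. -/
theorem harnack_log_norm {g : ℂ → ℂ} {z₀ z : ℂ} {r : ℝ}
    (hg : DifferentiableOn ℂ g (ball z₀ r)) (h1 : ∀ z ∈ ball z₀ r, 1 < ‖g z‖)
    (hz : ‖z - z₀‖ ≤ r / 2) (hr : 0 < r) : Real.log ‖g z‖ ≤ 3 * Real.log ‖g z₀‖ := by
  obtain ⟨h, hd, he⟩ := exists_exp_eq_on_ball hg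
    (fun z hz e => by have := h1 z hz; simp [e] at this; linarith)
  have hre : ∀ z ∈ ball z₀ r, Real.log ‖g z‖ = (h z).re := by
    intro z hz
    rw [← he z hz, Complex.norm_exp, Real.log_exp]
  have hpos : ∀ z ∈ ball z₀ r, 0 < (h z).re := by
    intro z hz; rw [← hre z hz]; exact Real.log_pos (h1 z hz)
  have hz₀ : z₀ ∈ ball z₀ r := mem_ball_self hr
  have hzr : z ∈ ball z₀ r := by rw [mem_ball_iff_norm]; linarith
  rw [hre z hzr, hre z₀ hz₀]
  set φ : ℂ → ℂ := fun w => h z₀ - h (w + z₀) with hφ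
  have hmem : ∀ w ∈ ball (0 : ℂ) r, w + z₀ ∈ ball z₀ r := by
    intro w hw; simpa [mem_ball_iff_norm] using hw
  have hw : z - z₀ ∈ ball (0 : ℂ) r := by
    rwa [mem_ball_zero_iff, ← mem_ball_iff_norm]
  have key := Complex.borelCaratheodory_zero (f := φ) (M := (h z₀).re) (R := r) (z := z - z₀)
    (hpos z₀ hz₀) ?_ ?_ hr hw ?_
  · have h2 : 2 * (h z₀).re * ‖z - z₀‖ / (r - ‖z - z₀‖) ≤ 2 * (h z₀).re := by
      rw [div_le_iff₀ (by linarith)]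
      have := hpos z₀ hz₀
      nlinarith
    have h3 := (Complex.abs_re_le_norm (φ (z - z₀))).trans (key.trans h2)
    simp only [hφ, sub_add_cancel, Complex.sub_re] at h3
    rw [abs_le] at h3
    linarith
  · refine (differentiableOn_const _).sub (hd.comp (by fun_prop) hmem)
  · intro w hw
    have := hpos _ (hmem w hw)
    simp only [hφ, Set.mem_ofPred_eq, Complex.sub_re]
    linarith
  · simp [hφ]

theorem harnack_log_norm_pair {g : ℂ → ℂ} {z₀ z z' : ℂ} {r : ℝ}
    (hg : DifferentiableOn ℂ g (ball z₀ r)) (h1 : ∀ z ∈ ball z₀ r, 1 < ‖g z‖)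
    (hz : z ∈ ball z₀ (r / 6)) (hz' : z' ∈ ball z₀ (r / 6)) (hr : 0 < r) :
    Real.log ‖g z‖ ≤ 3 * Real.log ‖g z'‖ := by
  rw [mem_ball] at hz hz'
  have hsub : ball z' (5 * r / 6) ⊆ ball z₀ r := by
    apply ball_subset_ball'; linarith
  refine harnack_log_norm (r := 5 * r / 6) (hg.mono hsub) (fun w hw => h1 w (hsub hw)) ?_
    (by linarith)
  rw [← dist_eq_norm]
  have := dist_triangle_right z z' z₀
  linarith

/-! ### Points escaping uniformly along a filter of parameters -/

theorem exists_uniform_escape {c : ℂ} {S : Set ℂ} (hS : IsCompact S) (hd : Disjoint S (K c)) :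
    ∃ N, ∀ n, N ≤ n → ∀ w ∈ S, escapeRadius c < ‖(f c)^[n] w‖ := by
  have hmono : ∀ {w : ℂ} {i j : ℕ}, i ≤ j → escapeRadius c < ‖(f c)^[i] w‖ →
      escapeRadius c < ‖(f c)^[j] w‖ := by
    intro w i j hij h
    induction j, hij using Nat.le_induction with
    | base => exact h
    | succ j _ ih =>
      rw [Function.iterate_succ_apply']
      have := two_mul_le_norm_f ih.le
      have := four_le_escapeRadius c
      linarith
  obtain ⟨N, hN⟩ := hS.elim_directed_cover (fun n => {w | escapeRadius c < ‖(f c)^[n] w‖})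
    (fun n => isOpen_lt continuous_const (continuous_iterate_f c n).norm)
    (fun w hw => by
      obtain ⟨n, hn⟩ := exists_iterate_large_of_notMem_K (Set.disjoint_left.1 hd hw)
      exact Set.mem_iUnion.2 ⟨n, hn⟩)
    (directed_of_isDirected_le fun i j hij w hw => hmono hij hw)
  exact ⟨N, fun n hn w hw => hmono hn (hN hw)⟩

/-- The set of points having a neighbourhood that is disjoint from `K c` for `c` along `U`. -/
def escapingAlong (U : Filter ℂ) : Set ℂ := {z | ∃ r > 0, ∀ᶠ c in U, Disjoint (ball z r) (K c)}

theorem isOpen_escapingAlong (U : Filter ℂ) : IsOpen (escapingAlong U) := by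
  rw [Metric.isOpen_iff]
  rintro z ⟨r, hr, h⟩
  refine ⟨r / 2, by positivity, fun w hw => ⟨r / 2, by positivity, h.mono fun c hc => ?_⟩⟩
  refine hc.mono_left (ball_subset_ball' ?_)
  rw [mem_ball] at hw
  linarith

theorem tendsto_iterate_f_param {U : Filter ℂ} {c₀ : ℂ} (hU : U ≤ 𝓝 c₀) (n : ℕ) (z : ℂ) :
    Tendsto (fun c => (f c)^[n] z) U (𝓝 ((f c₀)^[n] z)) := by
  have h : Continuous fun c => (f c)^[n] z :=
    (continuous_iterate_f_uncurry n).comp (continuous_id.prodMk continuous_const)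
  exact (h.tendsto c₀).mono_left hU

theorem harnack_iterate {c z : ℂ} {r : ℝ} (hd : Disjoint (ball z r) (K c)) {w w' : ℂ}
    (hw : w ∈ ball z (r / 6)) (hw' : w' ∈ ball z (r / 6)) :
    ∃ N, ∀ n, N ≤ n → (4 < ‖(f c)^[n] w'‖ ∧
      Real.log ‖(f c)^[n] w‖ ≤ 3 * Real.log ‖(f c)^[n] w'‖) := by
  have hr : 0 < r := by
    have := dist_nonneg.trans_lt (mem_ball.1 hw)
    linarith
  rw [mem_ball] at hw hw'
  obtain ⟨ρ, h1, h2⟩ := exists_between (show 6 * max (dist w z) (dist w' z) < r by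
    rw [← lt_div_iff₀' (by norm_num), max_lt_iff]; exact ⟨hw, hw'⟩)
  have h1w : 6 * dist w z < ρ := lt_of_le_of_lt (by gcongr; exact le_max_left _ _) h1
  have h1w' : 6 * dist w' z < ρ := lt_of_le_of_lt (by gcongr; exact le_max_right _ _) h1
  have hρ : 0 < ρ := by have := dist_nonneg (x := w) (y := z); linarith
  obtain ⟨N, hN⟩ := exists_uniform_escape (isCompact_closedBall z ρ)
    (hd.mono_left (closedBall_subset_ball h2))
  have h4 := four_le_escapeRadius c
  refine ⟨N, fun n hn => ⟨?_, ?_⟩⟩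
  · refine h4.trans_lt (hN n hn w' ?_)
    rw [mem_closedBall]
    have := dist_nonneg (x := w') (y := z)
    linarith
  · refine harnack_log_norm_pair (differentiable_iterate_f c n).differentiableOn (z₀ := z) (r := ρ)
      (fun y hy => ?_) ?_ ?_ hρ
    · have := hN n hn y (ball_subset_closedBall hy)
      linarith
    · rw [mem_ball]; linarith
    · rw [mem_ball]; linarith

/-- Uniformly escaping neighbourhoods have no recurrence. -/
theorem no_recurrence {U : Filter ℂ} [U.NeBot] {c₀ z w : ℂ} {r : ℝ} {m : ℕ} (hU : U ≤ 𝓝 c₀)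
    (h : ∀ᶠ c in U, Disjoint (ball z r) (K c)) (hm : 3 ≤ m) (hw : w ∈ ball z (r / 6))
    (hmw : (f c₀)^[m] w ∈ ball z (r / 6)) : False := by
  obtain ⟨c, hd, hc⟩ := (h.and ((tendsto_iterate_f_param hU m w).eventually
    (isOpen_ball.mem_nhds hmw))).exists
  obtain ⟨N, hN⟩ := harnack_iterate hd hc hw
  obtain ⟨N', hN'⟩ := exists_uniform_escape (isCompact_singleton (x := w)) (c := c)
    (hd.mono_left (Set.singleton_subset_iff.2 (ball_subset_ball (by
      have := dist_nonneg.trans_lt (mem_ball.1 hw)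
      linarith) hw)))
  obtain ⟨h4, hH⟩ := hN (max N N') (le_max_left _ _)
  have hR := hN' (max N N') (le_max_right _ _) w rfl
  set n := max N N'
  rw [← Function.iterate_add_apply, add_comm, Function.iterate_add_apply] at hH
  have hl := log_iterate_f_ge hR.le m
  set X := ‖(f c)^[n] w‖
  have hX : 2 * Real.log 2 < Real.log X := by
    have : Real.log 4 < Real.log X := Real.log_lt_log (by norm_num) h4
    rwa [show (4 : ℝ) = 2 ^ 2 by norm_num, Real.log_pow] at this
  have h2 := Real.log_pos (one_lt_two)
  have h8 : (8 : ℝ) ≤ 2 ^ m := by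
    calc (8 : ℝ) = 2 ^ 3 := by norm_num
      _ ≤ 2 ^ m := pow_le_pow_right₀ (by norm_num) hm
  nlinarith

theorem escapingAlong_inter_K_subset_interior {U : Filter ℂ} [U.NeBot] {c₀ : ℂ} (hU : U ≤ 𝓝 c₀) :
    escapingAlong U ∩ K c₀ ⊆ interior (K c₀) := by
  rintro z ⟨⟨r, hr, h⟩, hz⟩
  rw [mem_interior_iff_mem_nhds]
  refine mem_of_superset (ball_mem_nhds z (show 0 < r / 6 by positivity)) fun z' hz' => ?_
  by_contra hzK
  obtain ⟨j, hj⟩ := exists_iterate_large_of_notMem_K hzK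
  set R := escapeRadius c₀ + 1 with hR
  have hR4 := four_le_escapeRadius c₀
  have hl2 := Real.log_pos (one_lt_two)
  have key : ∀ i : ℕ, 2 ^ i * Real.log 2 ≤ 3 * Real.log (2 * R) := by
    intro i
    have e1 : ∀ᶠ c in U, escapeRadius c < ‖(f c)^[j] z'‖ := by
      have hcont : Tendsto (fun c => ‖(f c)^[j] z'‖ - escapeRadius c) U
          (𝓝 (‖(f c₀)^[j] z'‖ - escapeRadius c₀)) := by
        refine (tendsto_iterate_f_param hU j z').norm.sub ?_
        have : Continuous escapeRadius := by unfold escapeRadius; fun_prop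
        exact (this.tendsto c₀).mono_left hU
      filter_upwards [hcont.eventually (lt_mem_nhds (show (0:ℝ) < _ by linarith))] with c hc
      linarith
    have e2 : ∀ᶠ c in U, ‖(f c)^[j + i] z‖ < R := by
      refine (tendsto_iterate_f_param hU (j + i) z).norm.eventually (gt_mem_nhds ?_)
      have := mem_K_iff.1 hz (j + i)
      linarith
    have e3 : ∀ᶠ c in U, ‖c‖ < R := by
      have : Tendsto (fun c : ℂ => ‖c‖) U (𝓝 ‖c₀‖) := (continuous_norm.tendsto c₀).mono_left hU
      refine this.eventually (gt_mem_nhds ?_)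
      have := norm_le_escapeRadius c₀
      linarith
    obtain ⟨c, hd, h1, h2, h3⟩ := (h.and (e1.and (e2.and e3))).exists
    obtain ⟨N, hN⟩ := harnack_iterate hd hz' (mem_ball_self (show 0 < r / 6 by positivity))
    obtain ⟨h4, hH⟩ := hN (N + i + j) (by omega)
    have hlow := log_iterate_f_ge h1.le (N + i)
    rw [← Function.iterate_add_apply] at hlow
    have hup := norm_iterate_f_le c ((f c)^[j + i] z) (R := R) (by linarith) h3.le h2.le N
    rw [← Function.iterate_add_apply, show N + (j + i) = N + i + j by ring] at hup
    have hup' := Real.log_le_log (by linarith) hup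
    rw [Real.log_pow] at hup'
    have h4' : 2 * Real.log 2 ≤ Real.log ‖(f c)^[j] z'‖ := by
      have : Real.log 4 ≤ Real.log ‖(f c)^[j] z'‖ :=
        Real.log_le_log (by norm_num) ((four_le_escapeRadius c).trans h1.le)
      rwa [show (4 : ℝ) = 2 ^ 2 by norm_num, Real.log_pow] at this
    push_cast at hup'
    rw [pow_add] at hlow
    have hN0 : (0 : ℝ) < 2 ^ N := by positivity
    have hi0 : (0 : ℝ) < 2 ^ i := by positivity
    have : (2 : ℝ) ^ N * (2 ^ i * Real.log 2) ≤ 2 ^ N * (3 * Real.log (2 * R)) := by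
      have : (2 : ℝ) ^ N * 2 ^ i * Real.log 2 ≤
          2 ^ N * 2 ^ i * (Real.log ‖(f c)^[j] z'‖ - Real.log 2) := by
        gcongr; linarith
      linarith
    exact le_of_mul_le_mul_left this hN0
  obtain ⟨i, hi⟩ := pow_unbounded_of_one_lt (3 * Real.log (2 * R) / Real.log 2) (one_lt_two)
  rw [div_lt_iff₀ hl2] at hi
  exact absurd (key i) (not_le.2 hi)

theorem f_mem_escapingAlong {U : Filter ℂ} {c₀ z : ℂ} (hU : U ≤ 𝓝 c₀)
    (hz : z ∈ escapingAlong U) : f c₀ z ∈ escapingAlong U := by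
  obtain ⟨r, hr, h⟩ := hz
  refine ⟨r ^ 2 / 2, by positivity, ?_⟩
  filter_upwards [h, hU (ball_mem_nhds c₀ (show 0 < r ^ 2 / 2 by positivity))] with c hc hcc
  rw [Set.disjoint_left]
  intro w hw hwK
  obtain ⟨x, hx⟩ := IsAlgClosed.exists_pow_nat_eq (w - c) (show 0 < 2 by norm_num)
  have hfx : f c x = w := by simp [f, hx]
  have hxK : x ∈ K c := f_mem_K_iff.1 (hfx ▸ hwK)
  have hxK' : -x ∈ K c := neg_mem_K_iff.2 hxK
  have e : (x - z) * (x + z) = (w - f c₀ z) + (c₀ - c) := by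
    simp only [f]; linear_combination hx
  rw [mem_ball_iff_norm] at hw hcc
  have hlt : ‖x - z‖ * ‖x + z‖ < r * r := by
    rw [← norm_mul, e]
    refine (norm_add_le _ _).trans_lt ?_
    rw [norm_sub_rev c₀ c]
    nlinarith
  have h1 : r ≤ ‖x - z‖ := by
    by_contra! hlt
    exact Set.disjoint_left.1 hc (mem_ball_iff_norm.2 hlt) hxK
  have h2 : r ≤ ‖x + z‖ := by
    by_contra! hlt
    refine Set.disjoint_left.1 hc (mem_ball_iff_norm.2 ?_) hxK'
    rwa [show -x - z = -(x + z) by ring, norm_neg]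
  nlinarith

theorem iterate_f_mem_escapingAlong {U : Filter ℂ} {c₀ z : ℂ} (hU : U ≤ 𝓝 c₀)
    (hz : z ∈ escapingAlong U) (n : ℕ) : (f c₀)^[n] z ∈ escapingAlong U := by
  induction n with
  | zero => simpa
  | succ n ih => rw [Function.iterate_succ_apply']; exact f_mem_escapingAlong hU ih

/-! ### Normal families along ultrafilters -/

theorem exists_limit_along_ultrafilter {ι : Type*} (𝓥 : Ultrafilter ι) {U : Set ℂ} (hU : IsOpen U)
    {h : ι → ℂ → ℂ} (hd : ∀ i, DifferentiableOn ℂ (h i) U)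
    (hb : ∀ z ∈ U, ∃ r > 0, ∃ B : ℝ, ∀ᶠ i in (𝓥 : Filter ι), ∀ w ∈ ball z r ∩ U, ‖h i w‖ ≤ B) :
    ∃ g : ℂ → ℂ, DifferentiableOn ℂ g U ∧ TendstoLocallyUniformlyOn h g 𝓥 U := by
  have hlim : ∀ z : ℂ, ∃ y : ℂ, z ∈ U → Tendsto (fun i => h i z) 𝓥 (𝓝 y) := by
    intro z
    by_cases hz : z ∈ U
    · obtain ⟨r, hr, B, hB⟩ := hb z hz
      have hc : IsCompact (closedBall (0 : ℂ) B) := isCompact_closedBall 0 B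
      obtain ⟨y, -, hy⟩ := hc.ultrafilter_le_nhds (𝓥.map fun i => h i z) (by
        rw [le_principal_iff]
        refine hB.mono fun i hi => ?_
        rw [mem_closedBall_zero_iff]
        exact hi z ⟨mem_ball_self hr, hz⟩)
      exact ⟨y, fun _ => hy⟩
    · exact ⟨0, fun h => absurd h hz⟩
  choose g hg using hlim
  have hloc : TendstoLocallyUniformlyOn h g 𝓥 U := by
    rw [Metric.tendstoLocallyUniformlyOn_iff]
    intro ε hε z hz
    obtain ⟨r₁, hr₁, B, hB⟩ := hb z hz
    obtain ⟨r₂, hr₂, hr₂U⟩ := Metric.isOpen_iff.1 hU z hz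
    set r := min r₁ r₂ with hrdef
    have hr : 0 < r := lt_min hr₁ hr₂
    have hrU : ball z r ⊆ U := (ball_subset_ball (min_le_right _ _)).trans hr₂U
    have hLip : ∀ᶠ i in (𝓥 : Filter ι), ∀ w ∈ ball z (r / 2),
        ‖h i w - h i z‖ ≤ (2 * B) / r * ‖w - z‖ := by
      filter_upwards [hB] with i hi w hw
      have := Complex.dist_le_div_mul_dist_of_mapsTo_ball (f := h i) (c := z) (R₁ := r)
        (R₂ := 2 * B) (z := w) ((hd i).mono hrU) ?_ (ball_subset_ball (by linarith) hw)
      · simpa only [dist_eq_norm] using this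
      · intro y hy
        rw [mem_closedBall, dist_eq_norm]
        have h1 := hi y ⟨ball_subset_ball (min_le_left _ _) hy, hrU hy⟩
        have h2 := hi z ⟨mem_ball_self hr₁, hz⟩
        have := norm_sub_le (h i y) (h i z)
        linarith
    have hLg : ∀ w ∈ ball z (r / 2), ‖g w - g z‖ ≤ (2 * B) / r * ‖w - z‖ := by
      intro w hw
      have hwU : w ∈ U := hrU (ball_subset_ball (by linarith) hw)
      refine le_of_tendsto ((hg w hwU).sub (hg z hz)).norm ?_
      filter_upwards [hLip] with i hi using hi w hw
    have hB0 : 0 ≤ B := by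
      obtain ⟨i, hi⟩ := hB.exists
      exact (norm_nonneg _).trans (hi z ⟨mem_ball_self hr₁, hz⟩)
    set L := (2 * B) / r with hL
    have hL0 : 0 ≤ L := by positivity
    set s := min (r / 2) (ε / (4 * (L + 1))) with hs
    have hs0 : 0 < s := lt_min (by positivity) (by positivity)
    refine ⟨ball z s, mem_nhdsWithin_of_mem_nhds (ball_mem_nhds z hs0), ?_⟩
    have hz3 : ∀ᶠ i in (𝓥 : Filter ι), dist (h i z) (g z) < ε / 3 :=
      (Metric.tendsto_nhds.1 (hg z hz)) (ε / 3) (by positivity)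
    filter_upwards [hLip, hz3] with i hi hi3 w hw
    have hw2 : w ∈ ball z (r / 2) := ball_subset_ball (min_le_left _ _) hw
    have hsm : L * ‖w - z‖ ≤ ε / 4 := by
      rw [mem_ball_iff_norm] at hw
      have h1 : ‖w - z‖ ≤ ε / (4 * (L + 1)) := hw.le.trans (min_le_right _ _)
      calc L * ‖w - z‖ ≤ (L + 1) * (ε / (4 * (L + 1))) := by gcongr; linarith
        _ = ε / 4 := by field_simp
    have a1 := hi w hw2
    have a2 := hLg w hw2
    rw [dist_eq_norm] at hi3
    rw [dist_eq_norm]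
    have : g w - h i w = (g w - g z) - (h i z - g z) - (h i w - h i z) := by ring
    rw [this]
    have := norm_sub_le ((g w - g z) - (h i z - g z)) (h i w - h i z)
    have := norm_sub_le (g w - g z) (h i z - g z)
    linarith
  exact ⟨g, hloc.differentiableOn (Eventually.of_forall hd) hU, hloc⟩

/-- Hurwitz's theorem: values of a locally uniform limit are attained nearby. -/
theorem eventually_exists_eq_of_tendstoLocallyUniformlyOn {ι : Type*} {𝓕 : Filter ι} {U : Set ℂ}
    (hU : IsOpen U) {h : ι → ℂ → ℂ} {g : ℂ → ℂ} (hd : ∀ i, DifferentiableOn ℂ (h i) U)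
    (hg : DifferentiableOn ℂ g U) (hlim : TendstoLocallyUniformlyOn h g 𝓕 U) {z : ℂ} (hz : z ∈ U)
    (hne : ¬ ∀ᶠ w in 𝓝 z, g w = g z) {ε : ℝ} (hε : 0 < ε) :
    ∀ᶠ i in 𝓕, ∃ w ∈ ball z ε ∩ U, h i w = g z := by
  have hgz : AnalyticAt ℂ g z := hg.analyticAt (hU.mem_nhds hz)
  have hpunct : ∀ᶠ w in 𝓝[≠] z, g w ≠ g z :=
    (hgz.eventually_eq_or_eventually_ne analyticAt_const).resolve_left hne
  rw [eventually_nhdsWithin_iff, Metric.eventually_nhds_iff_ball] at hpunct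
  obtain ⟨r₁, hr₁, h1⟩ := hpunct
  obtain ⟨r₂, hr₂, h2⟩ := Metric.isOpen_iff.1 hU z hz
  obtain ⟨ρ, hρ, hρlt⟩ := exists_between (lt_min hε (lt_min hr₁ hr₂))
  simp only [lt_min_iff] at hρlt
  obtain ⟨hρε, hρ1, hρ2⟩ := hρlt
  have hcU : closedBall z ρ ⊆ U := (closedBall_subset_ball hρ2).trans h2
  have hne' : ∀ w ∈ sphere z ρ, 0 < ‖g w - g z‖ := by
    intro w hw
    have hw' := mem_sphere.1 hw
    refine norm_pos_iff.2 (sub_ne_zero.2 (h1 w (by rw [mem_ball, hw']; exact hρ1) ?_))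
    rintro rfl
    simp at hw'
    linarith
  have hsphne : (sphere z ρ).Nonempty := NormedSpace.sphere_nonempty.2 hρ.le
  obtain ⟨w₀, hw₀, hmin⟩ := (isCompact_sphere z ρ).exists_isMinOn hsphne
    (f := fun w => ‖g w - g z‖)
    ((hg.continuousOn.mono (sphere_subset_closedBall.trans hcU)).sub continuousOn_const).norm
  set δ := ‖g w₀ - g z‖ with hδ
  have hδ0 : 0 < δ := hne' w₀ hw₀
  have hunif : TendstoUniformlyOn h g 𝓕 (closedBall z ρ) :=
    (tendstoLocallyUniformlyOn_iff_forall_isCompact hU).1 hlim _ hcU (isCompact_closedBall z ρ)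
  filter_upwards [(Metric.tendstoUniformlyOn_iff.1 hunif) (δ / 8) (by positivity)] with i hi
  have hzi := hi z (mem_closedBall_self hρ.le)
  rw [dist_eq_norm] at hzi
  have hsph : ∀ w ∈ sphere z ρ, δ * (3 / 4) ≤ ‖h i w - h i z‖ := by
    intro w hw
    have e1 : δ ≤ ‖g w - g z‖ := hmin hw
    have e2 := hi w (sphere_subset_closedBall hw)
    rw [dist_eq_norm] at e2
    have e3 : g w - g z = (g w - h i w) - (g z - h i z) + (h i w - h i z) := by ring
    rw [e3] at e1
    have := norm_add_le ((g w - h i w) - (g z - h i z)) (h i w - h i z)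
    have := norm_sub_le (g w - h i w) (g z - h i z)
    linarith
  have hdc : DiffContOnCl ℂ (h i) (ball z ρ) := ((hd i).mono hcU).diffContOnCl_ball subset_rfl
  have hfreq : ∃ᶠ w in 𝓝 z, h i w ≠ h i z := by
    intro hev
    simp only [not_not] at hev
    have hEq : Set.EqOn (h i) (fun _ => h i z) (ball z ρ) :=
      (((hd i).mono (ball_subset_closedBall.trans hcU)).analyticOnNhd
        isOpen_ball).eqOn_of_preconnected_of_eventuallyEq analyticOnNhd_const
        (convex_ball z ρ).isPreconnected (mem_ball_self hρ) hev
    have hcl : Set.EqOn (h i) (fun _ => h i z) (closedBall z ρ) := by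
      rw [← closure_ball z hρ.ne']
      refine hEq.of_subset_closure ?_ continuousOn_const subset_closure subset_rfl
      rw [closure_ball z hρ.ne']
      exact (hd i).continuousOn.mono hcU
    have := hsph w₀ hw₀
    rw [hcl (sphere_subset_closedBall hw₀)] at this
    simp at this
    linarith
  have hball := hdc.ball_subset_image_closedBall hρ hsph hfreq
  obtain ⟨w, hw, hwe⟩ := hball (show g z ∈ _ by
    rw [mem_ball, dist_eq_norm]; linarith)
  exact ⟨w, ⟨closedBall_subset_ball hρε hw, hcU hw⟩, hwe⟩

/-! ### A Bloch-type estimate -/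

theorem norm_deriv_mul_le_of_omits {u : ℂ → ℂ} {U : Set ℂ} {a : ℂ} {R : ℝ} (hU : IsOpen U)
    (hu : DifferentiableOn ℂ u U) (hR : 0 < R) (haU : closedBall a R ⊆ U)
    (hom : ∀ z ∈ closedBall a R, ∀ w ∈ closedBall a R, u z ≠ u w + 2 * Real.pi * Complex.I) :
    ‖deriv u a‖ * R ≤ 96 * Real.pi := by
  have hdc : ContinuousOn (deriv u) U := (hu.deriv hU).continuousOn
  obtain ⟨s, hs, hmax⟩ := (isCompact_closedBall a R).exists_isMaxOn
    ⟨a, mem_closedBall_self hR.le⟩ (f := fun z => ‖deriv u z‖ * (R - ‖z - a‖))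
    ((hdc.mono haU).norm.mul (by fun_prop))
  have ha := hmax (mem_closedBall_self hR.le)
  simp only [Set.mem_ofPred_eq, sub_self, norm_zero, sub_zero] at ha
  refine ha.trans ?_
  set A := ‖deriv u s‖ with hA
  set t := R - ‖s - a‖ with ht
  by_contra! hcon
  have hpi := Real.pi_pos
  have ht0 : 0 ≤ t := by
    rw [mem_closedBall_iff_norm] at hs
    linarith
  have hA0 : 0 ≤ A := norm_nonneg _
  have htpos : 0 < t := by
    rcases ht0.eq_or_lt with h | h
    · rw [← h] at hcon; nlinarith
    · exact h
  have hApos : 0 < A := by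
    rcases hA0.eq_or_lt with h | h
    · rw [← h] at hcon; nlinarith
    · exact h
  have hsub : ball s (t / 2) ⊆ closedBall a R := by
    intro z hz
    rw [mem_ball_iff_norm] at hz
    rw [mem_closedBall_iff_norm]
    have := norm_add_le (z - s) (s - a)
    rw [sub_add_sub_cancel] at this
    linarith
  have hbd : ∀ z ∈ ball s (t / 2), ‖deriv u z‖ ≤ 2 * A := by
    intro z hz
    have h1 : ‖deriv u z‖ * (R - ‖z - a‖) ≤ A * t := hmax (hsub hz)
    rw [mem_ball_iff_norm] at hz
    have := norm_add_le (z - s) (s - a)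
    rw [sub_add_sub_cancel] at this
    have h2 : t / 2 ≤ R - ‖z - a‖ := by linarith
    have h3 := norm_nonneg (deriv u z)
    have h4 : ‖deriv u z‖ * (t / 2) ≤ A * t := (mul_le_mul_of_nonneg_left h2 h3).trans h1
    nlinarith
  have hvar : ∀ z ∈ ball s (t / 2), ‖deriv u z - deriv u s‖ ≤ (3 * A) / (t / 2) * ‖z - s‖ := by
    intro z hz
    have := Complex.dist_le_div_mul_dist_of_mapsTo_ball (f := deriv u) (c := s) (R₁ := t / 2)
        (R₂ := 3 * A) (z := z) ((hu.deriv hU).mono (hsub.trans haU)) ?_ hz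
    · simpa only [dist_eq_norm] using this
    · intro y hy
      rw [mem_closedBall, dist_eq_norm]
      have := norm_sub_le (deriv u y) (deriv u s)
      have := hbd y hy
      linarith
  set ρ := t / 12 with hρ
  have hρ0 : 0 < ρ := by positivity
  have hρsub : closedBall s ρ ⊆ ball s (t / 2) := closedBall_subset_ball (by linarith)
  have hLip : ∀ z ∈ closedBall s ρ, ‖(u z - deriv u s * z) - (u s - deriv u s * s)‖ ≤
      A / 2 * ‖z - s‖ := by
    intro z hz
    refine (convex_closedBall s ρ).norm_image_sub_le_of_norm_hasDerivWithin_le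
      (f := fun z => u z - deriv u s * z) (f' := fun z => deriv u z - deriv u s) ?_ ?_
      (mem_closedBall_self hρ0.le) hz
    · intro y hy
      have := (hu.differentiableAt (hU.mem_nhds (haU (hsub (hρsub hy))))).hasDerivAt
      have h2 := this.sub ((hasDerivAt_id y).const_mul (deriv u s))
      simp only [mul_one, id] at h2
      exact h2.hasDerivWithinAt
    · intro y hy
      refine (hvar y (hρsub hy)).trans ?_
      rw [mem_closedBall_iff_norm] at hy
      calc (3 * A) / (t / 2) * ‖y - s‖ ≤ (3 * A) / (t / 2) * ρ := by gcongr
        _ = A / 2 := by rw [hρ]; field_simp; norm_num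
  have hsph : ∀ z ∈ sphere s ρ, A / 2 * ρ ≤ ‖u z - u s‖ := by
    intro z hz
    have h1 := hLip z (sphere_subset_closedBall hz)
    rw [mem_sphere_iff_norm] at hz
    rw [hz] at h1
    have h2 : ‖deriv u s * (z - s)‖ = A * ρ := by rw [norm_mul, hz]
    have h3 : deriv u s * (z - s) =
      (u z - u s) - ((u z - deriv u s * z) - (u s - deriv u s * s)) := by ring
    rw [h3] at h2
    have := norm_sub_le (u z - u s) ((u z - deriv u s * z) - (u s - deriv u s * s))
    linarith
  have hdcl : DiffContOnCl ℂ u (ball s ρ) :=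
    (hu.mono (hρsub.trans (hsub.trans haU))).diffContOnCl_ball subset_rfl
  have hfreq : ∃ᶠ w in 𝓝 s, u w ≠ u s := by
    intro hev
    simp only [not_not] at hev
    have : deriv u s = 0 := by
      have h1 : u =ᶠ[𝓝 s] fun _ => u s := hev
      rw [h1.deriv_eq, deriv_const]
    rw [this, norm_zero] at hA
    linarith
  have hball := hdcl.ball_subset_image_closedBall hρ0 hsph hfreq
  obtain ⟨w, hw, hwe⟩ := hball (show u s + 2 * Real.pi * Complex.I ∈ _ by
    rw [mem_ball, dist_eq_norm, add_sub_cancel_left]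
    simp only [norm_mul, Complex.norm_ofNat, Complex.norm_real, Complex.norm_I, Real.norm_eq_abs,
      abs_of_pos hpi, mul_one]
    rw [hρ]
    nlinarith)
  exact hom w (hsub (hρsub hw)) s hs hwe

/-! ### Uniform bounds on preconnected sets -/

theorem locally_bounded_of_locally_equicontinuous {ι : Type*} {V : Set ℂ}
    (hVc : IsPreconnected V) {u : ι → ℂ → ℂ} {z₀ : ℂ} (hz₀ : z₀ ∈ V) (hu₀ : ∀ i, u i z₀ = 0)
    (hloc : ∀ a ∈ V, ∃ r > 0, ∃ L : ℝ, ∀ i, ∀ w ∈ ball a r, ‖u i w - u i a‖ ≤ L) :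
    ∀ a ∈ V, ∃ r > 0, ∃ B : ℝ, ∀ i, ∀ w ∈ ball a r, ‖u i w‖ ≤ B := by
  set S : Set ℂ := {a | ∃ r > 0, ∃ B : ℝ, ∀ i, ∀ w ∈ ball a r, ‖u i w‖ ≤ B} with hS
  have hSo : IsOpen S := by
    rw [Metric.isOpen_iff]
    rintro a ⟨r, hr, B, hB⟩
    refine ⟨r / 2, by positivity, fun b hb => ⟨r / 2, by positivity, B, fun i w hw => ?_⟩⟩
    refine hB i w (ball_subset_ball' ?_ hw)
    rw [mem_ball] at hb
    linarith
  refine hVc.subset_of_closure_inter_subset hSo ⟨z₀, hz₀, ?_⟩ ?_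
  · obtain ⟨r, hr, L, hL⟩ := hloc z₀ hz₀
    exact ⟨r, hr, L, fun i w hw => by simpa [hu₀] using hL i w hw⟩
  · rintro a ⟨haS, haV⟩
    obtain ⟨r, hr, L, hL⟩ := hloc a haV
    obtain ⟨b, ⟨r', hr', B, hB⟩, hab⟩ := Metric.mem_closure_iff.1 haS r hr
    refine ⟨r, hr, L + (L + B), fun i w hw => ?_⟩
    have h1 := hL i w hw
    have h2 := hL i b (by rw [mem_ball, dist_comm]; exact hab)
    have h3 := hB i b (mem_ball_self hr')
    have : u i w = (u i w - u i a) - (u i b - u i a) + u i b := by ring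
    rw [this]
    have := norm_add_le ((u i w - u i a) - (u i b - u i a)) (u i b)
    have := norm_sub_le (u i w - u i a) (u i b - u i a)
    linarith

/-! ### Components of the interior of the filled Julia set -/

/-- The component of the interior of `K c` containing `z`. -/
def interiorComponent (c z : ℂ) : Set ℂ := connectedComponentIn (interior (K c)) z

theorem isOpen_interiorComponent (c z : ℂ) : IsOpen (interiorComponent c z) :=
  isOpen_interior.connectedComponentIn

theorem isPreconnected_interiorComponent (c z : ℂ) : IsPreconnected (interiorComponent c z) :=
  isPreconnected_connectedComponentIn

theorem mem_interiorComponent {c z : ℂ} (h : z ∈ interior (K c)) : z ∈ interiorComponent c z :=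
  mem_connectedComponentIn h

theorem interiorComponent_subset (c z : ℂ) : interiorComponent c z ⊆ interior (K c) :=
  connectedComponentIn_subset _ _

theorem interiorComponent_subset_K (c z : ℂ) : interiorComponent c z ⊆ K c :=
  (interiorComponent_subset c z).trans interior_subset

theorem interiorComponent_eq {c z w : ℂ} (h : w ∈ interiorComponent c z) :
    interiorComponent c w = interiorComponent c z :=
  (connectedComponentIn_eq h).symm

theorem subset_interiorComponent {c z : ℂ} {S : Set ℂ} (hS : IsPreconnected S) (hz : z ∈ S)
    (hK : S ⊆ interior (K c)) : S ⊆ interiorComponent c z :=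
  hS.subset_connectedComponentIn hz hK

theorem f_mem_interiorComponent {c z w : ℂ} (h : w ∈ interiorComponent c z) :
    f c w ∈ interiorComponent c (f c z) := by
  have hz : z ∈ interior (K c) := by
    by_contra hz
    rw [interiorComponent, connectedComponentIn_eq_empty hz] at h
    exact h
  refine subset_interiorComponent
    ((isPreconnected_interiorComponent c z).image _ (differentiable_f c).continuous.continuousOn)
    ⟨z, mem_interiorComponent hz, rfl⟩ ?_ ⟨w, h, rfl⟩
  rintro _ ⟨y, hy, rfl⟩
  exact f_mem_interior_K (interiorComponent_subset _ _ hy)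

theorem iterate_f_mem_interiorComponent {c z w : ℂ} (h : w ∈ interiorComponent c z) (n : ℕ) :
    (f c)^[n] w ∈ interiorComponent c ((f c)^[n] z) := by
  induction n with
  | zero => simpa
  | succ n ih => simp only [Function.iterate_succ_apply']; exact f_mem_interiorComponent ih

theorem notMem_interior_of_mem_closure_interiorComponent {c z w : ℂ}
    (hw : w ∈ closure (interiorComponent c z)) (hw' : w ∉ interiorComponent c z) :
    w ∉ interior (K c) := by
  intro hi
  obtain ⟨y, hy, hyz⟩ := mem_closure_iff.1 hw _ (isOpen_interiorComponent c w)
    (mem_interiorComponent hi)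
  rw [← interiorComponent_eq hyz, interiorComponent_eq hy] at hw'
  exact hw' (mem_interiorComponent hi)

theorem subset_K_of_frontier_subset {c : ℂ} {B : Set ℂ} (hB : Bornology.IsBounded B)
    (hf : frontier B ⊆ K c) : B ⊆ K c := by
  intro z hz
  rw [mem_K_iff]
  intro n
  exact Complex.norm_le_of_forall_mem_frontier_norm_le hB
    (differentiable_iterate_f c n).diffContOnCl (fun w hw => mem_K_iff.1 (hf hw) n)
    (subset_closure hz)

theorem not_isBounded_connectedComponentIn_compl {c z₀ p : ℂ} {γ : Set ℂ} (hγ : IsCompact γ)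
    (hγV : γ ⊆ interiorComponent c z₀) (hp : p ∉ interiorComponent c z₀) :
    ¬ Bornology.IsBounded (connectedComponentIn γᶜ p) := by
  intro hb
  have hpγ : p ∈ γᶜ := fun h => hp (hγV h)
  set B := connectedComponentIn γᶜ p with hB
  have hBo : IsOpen B := hγ.isClosed.isOpen_compl.connectedComponentIn
  have hpB : p ∈ B := mem_connectedComponentIn hpγ
  have hfr : frontier B ⊆ γ := by
    intro w hw
    by_contra hwγ
    rw [hBo.frontier_eq] at hw
    obtain ⟨y, hy, hyB⟩ := mem_closure_iff.1 hw.1 (connectedComponentIn γᶜ w)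
      hγ.isClosed.isOpen_compl.connectedComponentIn (mem_connectedComponentIn hwγ)
    apply hw.2
    rw [hB, connectedComponentIn_eq hyB, ← connectedComponentIn_eq hy]
    exact mem_connectedComponentIn hwγ
  have hBK : B ⊆ interior (K c) := interior_maximal
    (subset_K_of_frontier_subset hb (hfr.trans (hγV.trans (interiorComponent_subset_K c z₀)))) hBo
  have hfrne : (frontier B).Nonempty := by
    refine nonempty_frontier_iff.2 ⟨⟨p, hpB⟩, ?_⟩
    intro h
    rw [h] at hb
    exact NormedSpace.unbounded_univ ℂ ℂ hb
  obtain ⟨w, hw⟩ := hfrne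
  have hwV := hγV (hfr hw)
  obtain ⟨y, hyV, hyB⟩ := mem_closure_iff.1 (frontier_subset_closure hw) _
    (isOpen_interiorComponent c z₀) hwV
  have := subset_interiorComponent isPreconnected_connectedComponentIn hyB hBK hpB
  rw [interiorComponent_eq hyV] at this
  exact hp this

/-! ### Logarithms on components -/

theorem eq_of_exp_eq_const {S : Set ℂ} (hS : IsPreconnected S) {h : ℂ → ℂ}
    (hc : ContinuousOn h S) {a : ℂ} (he : ∀ z ∈ S, Complex.exp (h z) = a) {z w : ℂ}
    (hz : z ∈ S) (hw : w ∈ S) : h z = h w := by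
  have hcount : {y : ℂ | Complex.exp y = a}.Countable := by
    refine (Set.countable_range fun n : ℤ => h z + n * (2 * Real.pi * Complex.I)).mono ?_
    intro y hy
    have hy' : Complex.exp y = Complex.exp (h z) := by rw [he z hz]; exact hy
    obtain ⟨n, hn⟩ := Complex.exp_eq_exp_iff_exists_int.1 hy'
    exact ⟨n, hn.symm⟩
  refine hcount.isTotallyDisconnected (h '' S) ?_ (hS.image h hc) ⟨z, hz, rfl⟩ ⟨w, hw, rfl⟩
  rintro _ ⟨y, hy, rfl⟩
  exact he y hy

theorem eq_of_exp_eq_exp {S : Set ℂ} (hS : IsPreconnected S) {h₁ h₂ : ℂ → ℂ}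
    (hc₁ : ContinuousOn h₁ S) (hc₂ : ContinuousOn h₂ S)
    (he : ∀ z ∈ S, Complex.exp (h₁ z) = Complex.exp (h₂ z)) {z w : ℂ}
    (hz : z ∈ S) (hw : w ∈ S) (heq : h₁ z = h₂ z) : h₁ w = h₂ w := by
  have := eq_of_exp_eq_const hS (hc₁.sub hc₂) (a := 1)
    (fun y hy => by simp [Complex.exp_sub, he y hy]) hz hw
  simp only [Pi.sub_apply, heq, sub_self] at this
  exact (sub_eq_zero.1 this.symm)

/-- `HasLogOn γ ζ`: there is a continuous branch of `log (z - ζ)` on `γ`. -/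
def HasLogOn (γ : Set ℂ) (ζ : ℂ) : Prop :=
  ∃ l : ℂ → ℂ, ContinuousOn l γ ∧ ∀ z ∈ γ, Complex.exp (l z) = z - ζ

theorem HasLogOn.of_norm_sub_lt {γ : Set ℂ} {ζ ξ : ℂ} (h : HasLogOn γ ζ)
    (hlt : ∀ z ∈ γ, ‖ξ - ζ‖ < ‖z - ζ‖) : HasLogOn γ ξ := by
  obtain ⟨l, hl, he⟩ := h
  have hne : ∀ z ∈ γ, z - ζ ≠ 0 := fun z hz => by
    rw [← norm_pos_iff]; exact (norm_nonneg _).trans_lt (hlt z hz)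
  have hsl : ∀ z ∈ γ, (z - ξ) / (z - ζ) ∈ Complex.slitPlane := by
    intro z hz
    have : (z - ξ) / (z - ζ) = 1 + -((ξ - ζ) / (z - ζ)) := by
      field_simp [hne z hz]; ring
    rw [this]
    apply Complex.mem_slitPlane_of_norm_lt_one
    rw [norm_neg, norm_div, div_lt_one (norm_pos_iff.2 (hne z hz))]
    exact hlt z hz
  refine ⟨fun z => l z + Complex.log ((z - ξ) / (z - ζ)), hl.add ?_, ?_⟩
  · refine ContinuousOn.clog (ContinuousOn.div (by fun_prop) (by fun_prop) hne) hsl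
  · intro z hz
    rw [Complex.exp_add, he z hz, Complex.exp_log (Complex.slitPlane_ne_zero (hsl z hz))]
    field_simp [hne z hz]

theorem hasLogOn_of_unbounded {γ : Set ℂ} (hγ : IsCompact γ) {p : ℂ}
    (hub : ¬ Bornology.IsBounded (connectedComponentIn γᶜ p)) : HasLogOn γ p := by
  set B := connectedComponentIn γᶜ p with hB
  have hsep : ∀ a ∈ γᶜ, ∃ d > 0, ∀ z ∈ γ, d ≤ ‖z - a‖ := by
    intro a ha
    obtain ⟨d, hd, h⟩ := Metric.isOpen_iff.1 hγ.isClosed.isOpen_compl a ha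
    refine ⟨d, hd, fun z hz => ?_⟩
    by_contra! hlt
    exact h (mem_ball_iff_norm.2 hlt) hz
  have hpB : p ∈ B := by
    refine mem_connectedComponentIn ?_
    by_contra h
    rw [hB, connectedComponentIn_eq_empty h] at hub
    exact hub Bornology.isBounded_empty
  obtain ⟨R, hR⟩ := isBounded_iff_forall_norm_le.1 hγ.isBounded
  have hfar : ∃ ζ ∈ B, R < ‖ζ‖ := by
    by_contra! hcon
    exact hub (isBounded_iff_forall_norm_le.2 ⟨R, hcon⟩)
  obtain ⟨ζ, hζB, hζR⟩ := hfar
  have hζ : ζ ∈ {a | a ∈ γᶜ ∧ HasLogOn γ a} := by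
    refine ⟨connectedComponentIn_subset _ _ hζB, ?_⟩
    have hne : ∀ z ∈ γ, ζ ≠ 0 := by
      rintro z hz rfl
      have := hR z hz
      have := norm_nonneg z
      simp at hζR
      linarith
    have hsl : ∀ z ∈ γ, 1 + -(z / ζ) ∈ Complex.slitPlane := by
      intro z hz
      apply Complex.mem_slitPlane_of_norm_lt_one
      rw [norm_neg, norm_div, div_lt_one (norm_pos_iff.2 (hne z hz))]
      exact (hR z hz).trans_lt hζR
    refine ⟨fun z => Complex.log (-ζ) + Complex.log (1 + -(z / ζ)), ?_, ?_⟩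
    · exact continuousOn_const.add (ContinuousOn.clog (by fun_prop) hsl)
    · intro z hz
      have h0 := hne z hz
      rw [Complex.exp_add, Complex.exp_log (neg_ne_zero.2 h0),
        Complex.exp_log (Complex.slitPlane_ne_zero (hsl z hz))]
      field_simp
      ring
  have hopen : IsOpen {a | a ∈ γᶜ ∧ HasLogOn γ a} := by
    rw [Metric.isOpen_iff]
    rintro a ⟨ha, hL⟩
    obtain ⟨d, hd, h⟩ := hsep a ha
    refine ⟨d, hd, fun b hb => ?_⟩
    rw [mem_ball_iff_norm] at hb
    refine ⟨fun hbγ => ?_, hL.of_norm_sub_lt fun z hz => hb.trans_le (h z hz)⟩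
    exact absurd (h b hbγ) (not_le.2 hb)
  refine (IsPreconnected.subset_of_closure_inter_subset (s := B)
    isPreconnected_connectedComponentIn hopen ⟨ζ, hζB, hζ⟩ ?_ hpB).2
  rintro a ⟨hac, haB⟩
  have ha := connectedComponentIn_subset _ _ haB
  obtain ⟨d, hd, h⟩ := hsep a ha
  obtain ⟨b, ⟨-, hb⟩, hab⟩ := Metric.mem_closure_iff.1 hac (d / 2) (by positivity)
  rw [dist_eq_norm] at hab
  refine ⟨ha, hb.of_norm_sub_lt fun z hz => hab.trans ?_⟩
  have h1 := h z hz
  have h2 := norm_add_le (z - b) (b - a)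
  rw [sub_add_sub_cancel, norm_sub_rev b a] at h2
  linarith

/-- Continuous logarithms on all compact subsets of a connected open set glue. -/
theorem hasLogOn_of_forall_isCompact {V : Set ℂ} (hV : IsOpen V) (hc : IsPreconnected V) {p : ℂ}
    (h : ∀ γ ⊆ V, IsCompact γ → HasLogOn γ p) : HasLogOn V p := by
  rcases V.eq_empty_or_nonempty with rfl | ⟨z₀, hz₀⟩
  · exact ⟨0, by simp, by simp⟩
  have hpath : ∀ z ∈ V, ∃ γ ⊆ V, IsCompact γ ∧ IsPreconnected γ ∧ z₀ ∈ γ ∧ z ∈ γ := by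
    intro z hz
    have hpc := hV.isConnected_iff_isPathConnected.1 ⟨⟨z₀, hz₀⟩, hc⟩
    obtain ⟨q, hq⟩ := hpc.joinedIn z₀ hz₀ z hz
    refine ⟨Set.range q, ?_, isCompact_range q.continuous, isPreconnected_range q.continuous,
      ⟨0, q.source⟩, ⟨1, q.target⟩⟩
    rintro _ ⟨t, rfl⟩
    exact hq t
  have hnorm : ∀ γ ⊆ V, IsCompact γ → ∃ l : ℂ → ℂ, ContinuousOn l γ ∧
      (∀ z ∈ γ, Complex.exp (l z) = z - p) ∧ (z₀ ∈ γ → l z₀ = Complex.log (z₀ - p)) := by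
    intro γ hγ hγc
    obtain ⟨l, hl, he⟩ := h γ hγ hγc
    by_cases h0 : z₀ ∈ γ
    · have hne : z₀ - p ≠ 0 := by rw [← he z₀ h0]; exact Complex.exp_ne_zero _
      refine ⟨fun z => l z + (Complex.log (z₀ - p) - l z₀), hl.add continuousOn_const, ?_, ?_⟩
      · intro z hz
        rw [Complex.exp_add, Complex.exp_sub, Complex.exp_log hne, he z hz, he z₀ h0,
          div_self hne, mul_one]
      · intro; ring
    · exact ⟨l, hl, he, fun h => absurd h h0⟩
  choose! γ hγV hγc hγp hγ0 hγz using hpath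
  choose! l hl he hl0 using hnorm
  have huniq : ∀ γ₁ ⊆ V, ∀ γ₂ ⊆ V, IsCompact γ₁ → IsCompact γ₂ → IsPreconnected γ₁ →
      IsPreconnected γ₂ → z₀ ∈ γ₁ → z₀ ∈ γ₂ → ∀ z ∈ γ₁, z ∈ γ₂ → l γ₁ z = l γ₂ z := by
    have hone : ∀ γ₁ ⊆ V, ∀ γ₂ ⊆ V, IsCompact γ₁ → IsCompact γ₂ → IsPreconnected γ₁ →
        γ₁ ⊆ γ₂ → z₀ ∈ γ₁ → ∀ z ∈ γ₁, l γ₁ z = l γ₂ z := by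
      intro γ₁ h1 γ₂ h2 c1 c2 p1 hsub h0 z hz
      refine eq_of_exp_eq_exp p1 (hl γ₁ h1 c1) ((hl γ₂ h2 c2).mono hsub) ?_ h0 hz ?_
      · intro w hw
        rw [he γ₁ h1 c1 w hw, he γ₂ h2 c2 w (hsub hw)]
      · rw [hl0 γ₁ h1 c1 h0, hl0 γ₂ h2 c2 (hsub h0)]
    intro γ₁ h1 γ₂ h2 c1 c2 p1 p2 z1 z2 z hz1 hz2
    rw [hone γ₁ h1 (γ₁ ∪ γ₂) (Set.union_subset h1 h2) c1 (c1.union c2) p1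
        Set.subset_union_left z1 z hz1,
      hone γ₂ h2 (γ₁ ∪ γ₂) (Set.union_subset h1 h2) c2 (c1.union c2) p2
        Set.subset_union_right z2 z hz2]
  refine ⟨fun z => l (γ z) z, ?_, fun z hz => he _ (hγV z hz) (hγc z hz) z (hγz z hz)⟩
  intro z hz
  obtain ⟨r, hr, hrV⟩ := nhds_basis_closedBall.mem_iff.1 (hV.mem_nhds hz)
  set Γ := γ z ∪ closedBall z r with hΓ
  have hΓV : Γ ⊆ V := Set.union_subset (hγV z hz) hrV
  have hΓc : IsCompact Γ := (hγc z hz).union (isCompact_closedBall z r)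
  have hΓp : IsPreconnected Γ := (hγp z hz).union z (hγz z hz) (mem_closedBall_self hr.le)
    (convex_closedBall z r).isPreconnected
  have hcont : ContinuousAt (l Γ) z := (hl Γ hΓV hΓc).continuousAt
    (mem_of_superset (closedBall_mem_nhds z hr) Set.subset_union_right)
  refine (hcont.congr ?_).continuousWithinAt
  filter_upwards [closedBall_mem_nhds z hr] with w hw
  exact huniq Γ hΓV _ (hγV w (hrV hw)) hΓc (hγc w (hrV hw)) hΓp (hγp w (hrV hw))
    (Or.inl (hγ0 z hz)) (hγ0 w (hrV hw)) w (Or.inr hw) (hγz w (hrV hw))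

theorem differentiableOn_of_exp_eq {V : Set ℂ} (hV : IsOpen V) {l : ℂ → ℂ} {p : ℂ}
    (hl : ContinuousOn l V) (he : ∀ z ∈ V, Complex.exp (l z) = z - p) :
    DifferentiableOn ℂ l V := by
  intro z hz
  have h1 : HasDerivAt (fun y => Complex.exp y + p) (Complex.exp (l z)) (l z) :=
    (Complex.hasDerivAt_exp _).add_const p
  refine (HasDerivAt.of_local_left_inverse (hl.continuousAt (hV.mem_nhds hz)) h1
    (Complex.exp_ne_zero _) ?_).differentiableAt.differentiableWithinAt
  filter_upwards [hV.mem_nhds hz] with w hw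
  rw [he w hw]
  ring

theorem exists_log_on_interiorComponent {c z₀ p : ℂ} (hp : p ∉ interiorComponent c z₀) :
    ∃ l : ℂ → ℂ, DifferentiableOn ℂ l (interiorComponent c z₀) ∧
      ∀ z ∈ interiorComponent c z₀, Complex.exp (l z) = z - p := by
  obtain ⟨l, hl, he⟩ := hasLogOn_of_forall_isCompact (isOpen_interiorComponent c z₀)
    (isPreconnected_interiorComponent c z₀) (p := p) fun γ hγ hγc =>
      hasLogOn_of_unbounded hγc (not_isBounded_connectedComponentIn_compl hγc hγ hp)
  exact ⟨l, differentiableOn_of_exp_eq (isOpen_interiorComponent c z₀) hl he, he⟩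

/-! ### The snail lemma -/

theorem exists_near_two_pi_mul {θ δ : ℝ} (hδ : 0 < δ) :
    ∃ (q : ℕ) (j : ℤ), 1 ≤ q ∧ |q * θ - 2 * Real.pi * j| < δ := by
  have hpi := Real.pi_pos
  obtain ⟨n, hn⟩ := exists_nat_gt (2 * Real.pi / δ)
  obtain ⟨j, k, hk, -, hle⟩ := Real.exists_int_int_abs_mul_sub_le (θ / (2 * Real.pi)) n.succ_pos
  lift k to ℕ using hk.le
  refine ⟨k, j, by exact_mod_cast hk, ?_⟩
  have e : (k : ℝ) * θ - 2 * Real.pi * j =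
      (2 * Real.pi) * (((k : ℤ) : ℝ) * (θ / (2 * Real.pi)) - j) := by
    push_cast; field_simp
  rw [e, abs_mul, abs_of_pos (by positivity)]
  rw [div_lt_iff₀ hδ] at hn
  push_cast at hle
  have hn0 : (0 : ℝ) < (n : ℝ) + 1 + 1 := by positivity
  rw [le_div_iff₀ hn0] at hle
  push_cast
  by_contra! hcon
  have hX := abs_nonneg ((k : ℝ) * (θ / (2 * Real.pi)) - j)
  set X := |(k : ℝ) * (θ / (2 * Real.pi)) - j|
  have h1 : δ * (n + 1 + 1) ≤ (2 * Real.pi * X) * (n + 1 + 1) := by gcongr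
  nlinarith

theorem snail_lemma {V : Set ℂ} (hV : IsOpen V) (hVc : IsPreconnected V) {F l : ℂ → ℂ}
    {p z₀ : ℂ} (hl : DifferentiableOn ℂ l V) (he : ∀ z ∈ V, Complex.exp (l z) = z - p)
    (hF : Differentiable ℂ F) (hFV : ∀ w ∈ V, F w ∈ V)
    (hconv : ∀ w ∈ V, Tendsto (fun k => F^[k] w) atTop (𝓝 p)) (hFp : F p = p)
    (hnorm : ‖deriv F p‖ = 1) (hne : deriv F p ≠ 1) (hz₀ : z₀ ∈ V) : False := by
  have hpi := Real.pi_pos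
  have hit : ∀ k : ℕ, ∀ w ∈ V, F^[k] w ∈ V := by
    intro k
    induction k with
    | zero => intro w hw; simpa
    | succ k ih => intro w hw; rw [Function.iterate_succ_apply']; exact hFV _ (ih w hw)
  set u : ℕ → ℂ → ℂ := fun k w => l (F^[k] w) - l (F^[k] z₀) with hu
  have hud : ∀ k, DifferentiableOn ℂ (u k) V := fun k =>
    (hl.comp (hF.iterate k).differentiableOn (hit k)).sub_const _
  have homit : ∀ k, ∀ w ∈ V, ∀ w' ∈ V, ∀ j : ℤ,
      u k w = u k w' + j * (2 * Real.pi * Complex.I) → j = 0 := by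
    intro k w hw w' hw' j h
    have h1 : l (F^[k] w) = l (F^[k] w') + j * (2 * Real.pi * Complex.I) := by
      simp only [hu] at h
      linear_combination h
    have h2 : F^[k] w = F^[k] w' := by
      have h3 := congrArg Complex.exp h1
      rw [Complex.exp_add, Complex.exp_int_mul_two_pi_mul_I, mul_one, he _ (hit k w hw),
        he _ (hit k w' hw')] at h3
      linear_combination h3
    rw [h2] at h1
    have h4 : (j : ℂ) * (2 * Real.pi * Complex.I) = 0 := by linear_combination -h1
    rcases mul_eq_zero.1 h4 with h | h
    · exact_mod_cast h
    · exact absurd h Complex.two_pi_I_ne_zero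
  have hloc : ∀ a ∈ V, ∃ r > 0, ∃ L : ℝ, ∀ k, ∀ w ∈ ball a r, ‖u k w - u k a‖ ≤ L := by
    intro a ha
    obtain ⟨R, hR, hRV⟩ := nhds_basis_closedBall.mem_iff.1 (hV.mem_nhds ha)
    refine ⟨R / 2, by positivity, 96 * Real.pi, fun k w hw => ?_⟩
    have hder : ∀ b ∈ ball a (R / 2), ‖deriv (u k) b‖ ≤ 192 * Real.pi / R := by
      intro b hb
      have hbV : closedBall b (R / 2) ⊆ V := by
        refine (closedBall_subset_closedBall' ?_).trans hRV
        rw [mem_ball] at hb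
        linarith
      have := norm_deriv_mul_le_of_omits hV (hud k) (a := b) (R := R / 2) (by positivity) hbV ?_
      · rw [le_div_iff₀ hR]; linarith
      · intro z hz z' hz' h
        have := homit k z (hbV hz) z' (hbV hz') 1 (by rw [h]; push_cast; ring)
        exact one_ne_zero this
    have hbU : ball a (R / 2) ⊆ V :=
      (ball_subset_closedBall.trans (closedBall_subset_closedBall (by linarith))).trans hRV
    have := (convex_ball a (R / 2)).norm_image_sub_le_of_norm_deriv_le (f := u k)
      (fun x hx => (hud k).differentiableAt (hV.mem_nhds (hbU hx))) hder
      (mem_ball_self (by positivity)) hw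
    refine this.trans ?_
    rw [mem_ball_iff_norm] at hw
    calc 192 * Real.pi / R * ‖w - a‖ ≤ 192 * Real.pi / R * (R / 2) := by gcongr
      _ = 96 * Real.pi := by field_simp; norm_num
  have hbdd := locally_bounded_of_locally_equicontinuous hVc hz₀ (u := u)
    (fun k => by simp [hu]) hloc
  set 𝓥 : Ultrafilter ℕ := Ultrafilter.of atTop with h𝓥
  have h𝓥le : (𝓥 : Filter ℕ) ≤ atTop := Ultrafilter.of_le _
  obtain ⟨g, hgd, hg⟩ := exists_limit_along_ultrafilter 𝓥 hV hud (fun z hz => by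
    obtain ⟨r, hr, B, hB⟩ := hbdd z hz
    exact ⟨r, hr, B, Eventually.of_forall fun k w hw => hB k w hw.1⟩)
  have hgpt : ∀ w ∈ V, Tendsto (fun k => u k w) 𝓥 (𝓝 (g w)) := fun w hw => hg.tendsto_at hw
  have hg0 : g z₀ = 0 := by
    refine tendsto_nhds_unique (hgpt z₀ hz₀) ?_
    simp [hu]
  have hVp : ∀ w ∈ V, w ≠ p := by
    rintro w hw rfl
    have := he w hw
    rw [sub_self] at this
    exact Complex.exp_ne_zero _ this
  have hexp : ∀ w ∈ V, Complex.exp (g (F w) - g w) = deriv F p := by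
    intro w hw
    have h1 : Tendsto (fun k => Complex.exp (u k (F w) - u k w)) 𝓥
        (𝓝 (Complex.exp (g (F w) - g w))) :=
      ((Complex.continuous_exp.tendsto _).comp ((hgpt _ (hFV w hw)).sub (hgpt w hw)))
    refine tendsto_nhds_unique h1 ?_
    have hs := hasDerivAt_iff_tendsto_slope.1 (hF p).hasDerivAt
    have ht : Tendsto (fun k => F^[k] w) atTop (𝓝[≠] p) :=
      tendsto_nhdsWithin_iff.2 ⟨hconv w hw, Eventually.of_forall fun k => hVp _ (hit k w hw)⟩
    refine ((hs.comp ht).mono_left h𝓥le).congr fun k => ?_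
    simp only [Function.comp, hu, slope_def_field, hFp]
    rw [show l (F^[k] (F w)) - l (F^[k] z₀) - (l (F^[k] w) - l (F^[k] z₀)) =
      l (F^[k] (F w)) - l (F^[k] w) by ring, Complex.exp_sub, he _ (hit k _ (hFV w hw)),
      he _ (hit k w hw), ← Function.iterate_succ_apply, Function.iterate_succ_apply']
  set κ := g (F z₀) - g z₀ with hκ
  have hκw : ∀ w ∈ V, g (F w) = g w + κ := by
    intro w hw
    have : g (F w) - g w = κ := eq_of_exp_eq_const hVc
      (h := fun w => g (F w) - g w)
      ((hgd.continuousOn.comp hF.continuous.continuousOn hFV).sub hgd.continuousOn) hexp hw hz₀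
    linear_combination this
  have hκexp : Complex.exp κ = deriv F p := hexp z₀ hz₀
  have hκre : κ.re = 0 := by
    have := hnorm
    rw [← hκexp, Complex.norm_exp, Real.exp_eq_one_iff] at this
    exact this
  set θ := κ.im with hθ
  have hκI : κ = θ * Complex.I := by
    apply Complex.ext <;> simp [hκre, hθ]
  have hθ0 : θ ≠ 0 := by
    intro h
    rw [h] at hκI
    rw [hκI] at hκexp
    simp at hκexp
    exact hne hκexp.symm
  have hgq : ∀ q : ℕ, ∀ w ∈ V, g (F^[q] w) = g w + q * κ := by
    intro q
    induction q with
    | zero => intro w hw; simp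
    | succ q ih =>
      intro w hw
      rw [Function.iterate_succ_apply', hκw _ (hit q w hw), ih w hw]
      push_cast; ring
  have hnonconst : ¬ ∃ y, ∀ z ∈ V, g z = y := by
    rintro ⟨y, hy⟩
    have h1 := hκw z₀ hz₀
    rw [hy _ hz₀, hy _ (hFV _ hz₀)] at h1
    have h2 : κ = 0 := by linear_combination -h1
    apply hθ0
    rw [hθ, h2]; simp
  have hga : AnalyticOnNhd ℂ g V := hgd.analyticOnNhd hV
  have hopen := (hga.is_constant_or_isOpen hVc).resolve_left hnonconst V subset_rfl hV
  obtain ⟨δ, hδ, hδsub⟩ := Metric.isOpen_iff.1 hopen 0 ⟨z₀, hz₀, hg0⟩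
  obtain ⟨q, j, hq, hqj⟩ := exists_near_two_pi_mul (θ := θ) (lt_min hδ (abs_pos.2 hθ0))
  have hj : j ≠ 0 := by
    rintro rfl
    have h1 := hqj.trans_le (min_le_right _ _)
    rw [Int.cast_zero, mul_zero, sub_zero, abs_mul, Nat.abs_cast] at h1
    have h2 : (1 : ℝ) ≤ q := by exact_mod_cast hq
    have h3 := abs_pos.2 hθ0
    nlinarith
  obtain ⟨w, hw, hgw⟩ := hδsub (show (-((q * θ - 2 * Real.pi * j : ℝ) : ℂ) * Complex.I) ∈ _ by
    rw [mem_ball_zero_iff, norm_mul, norm_neg, Complex.norm_real, Complex.norm_I, mul_one,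
      Real.norm_eq_abs]
    exact hqj.trans_le (min_le_left _ _))
  set a := F^[q] w with ha
  have haV : a ∈ V := hit q w hw
  have hgaj : g a = j * (2 * Real.pi * Complex.I) := by
    rw [ha, hgq q w hw, hgw, hκI]
    push_cast; ring
  have hnc : ¬ ∀ᶠ y in 𝓝 a, g y = g a := by
    intro h
    exact hnonconst ⟨g a, hga.eqOn_of_preconnected_of_eventuallyEq analyticOnNhd_const hVc haV h⟩
  obtain ⟨k, w', hw', hk⟩ := (eventually_exists_eq_of_tendstoLocallyUniformlyOn hV hud hgd hg haV
    hnc one_pos).exists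
  refine hj (homit k w' hw'.2 z₀ hz₀ j ?_)
  rw [hk, hgaj]
  simp [hu]

/-! ### Uniformly escaping points in periodic components -/

theorem exists_ball_subset_K_of_attracting {c₀ p : ℂ} {m : ℕ} (hm : 1 ≤ m)
    (hp : (f c₀)^[m] p = p) (hlt : ‖deriv (f c₀)^[m] p‖ < 1) :
    ∃ ε > 0, ∀ᶠ c in 𝓝 c₀, ball p ε ⊆ K c := by
  obtain ⟨q, hq, hq1⟩ := exists_between hlt
  have hd := (differentiable_iterate_f c₀ m p).hasDerivAt
  have ho := (hasDerivAt_iff_isLittleO.1 hd).def (sub_pos.2 hq)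
  obtain ⟨ε, hε, hball⟩ := nhds_basis_closedBall.eventually_iff.1 ho
  have hmaps : ∀ w ∈ closedBall p ε, (f c₀)^[m] w ∈ ball p ε := by
    intro w hw
    have h1 := hball hw
    rw [hp, smul_eq_mul] at h1
    rw [mem_closedBall_iff_norm] at hw
    rw [mem_ball_iff_norm]
    have h2 : (f c₀)^[m] w - p = ((f c₀)^[m] w - p - (w - p) * deriv (f c₀)^[m] p) +
      (w - p) * deriv (f c₀)^[m] p := by ring
    rw [h2]
    refine (norm_add_le _ _).trans_lt ?_
    rw [norm_mul]
    have := norm_nonneg (w - p)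
    have h3 : q * ‖w - p‖ ≤ q * ε := by
      gcongr
      exact (norm_nonneg _).trans hq.le
    nlinarith
  have hev : ∀ᶠ c in 𝓝 c₀, ∀ w ∈ closedBall p ε, (f c)^[m] w ∈ ball p ε := by
    refine (isCompact_closedBall p ε).eventually_forall_of_forall_eventually fun w hw => ?_
    exact ((continuous_iterate_f_uncurry m).tendsto (c₀, w)).eventually
      (isOpen_ball.mem_nhds (hmaps w hw))
  refine ⟨ε, hε, hev.mono fun c hc w hw => ?_⟩
  rw [mem_K_iff_isBounded]
  have hbd : Bornology.IsBounded (⋃ i ∈ Finset.range m, (f c)^[i] '' closedBall p ε) := by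
    rw [Bornology.isBounded_biUnion_finset]
    intro i _
    exact ((isCompact_closedBall p ε).image (continuous_iterate_f c i)).isBounded
  refine hbd.subset ?_
  rintro _ ⟨n, rfl⟩
  have hk : ∀ k, (f c)^[m * k] w ∈ closedBall p ε := by
    intro k
    induction k with
    | zero => simpa using ball_subset_closedBall hw
    | succ k ih =>
      rw [mul_add, mul_one, add_comm, Function.iterate_add_apply]
      exact ball_subset_closedBall (hc _ ih)
  refine Set.mem_biUnion (x := n % m) (by simpa using Nat.mod_lt _ hm)
    ⟨(f c)^[m * (n / m)] w, hk _, ?_⟩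
  rw [← Function.iterate_add_apply, Nat.mod_add_div]

theorem frequently_exit {S : Set ℕ} (h₁ : ∃ᶠ k in atTop, k ∈ S) (h₂ : ∃ᶠ k in atTop, k ∉ S) :
    ∃ᶠ k in atTop, k ∈ S ∧ k + 1 ∉ S := by
  by_contra hcon
  rw [not_frequently, eventually_atTop] at hcon
  obtain ⟨N, hN⟩ := hcon
  obtain ⟨k, hkN, hk⟩ := frequently_atTop.1 h₁ N
  obtain ⟨j, hj, hjS⟩ := frequently_atTop.1 h₂ k
  apply hjS
  clear hjS
  induction j, hj using Nat.le_induction with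
  | base => exact hk
  | succ j hkj ih =>
    by_contra h
    exact hN j (hkN.trans hkj) ⟨ih, h⟩

theorem isolated_fixed_point (c p : ℂ) {m : ℕ} (hm : 1 ≤ m) :
    ∀ᶠ w in 𝓝[≠] p, (f c)^[m] w ≠ w := by
  have ha : AnalyticOnNhd ℂ (fun w => (f c)^[m] w - w) Set.univ :=
    ((differentiable_iterate_f c m).sub differentiable_id).differentiableOn.analyticOnNhd
      isOpen_univ
  rcases (ha p trivial).eventually_eq_zero_or_eventually_ne_zero with h | h
  · exfalso
    have hz := ha.eqOn_zero_of_preconnected_of_eventuallyEq_zero isPreconnected_univ trivial h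
    set w : ℂ := ((escapeRadius c + 1 : ℝ) : ℂ) with hw
    have h4 := four_le_escapeRadius c
    have hwn : ‖w‖ = escapeRadius c + 1 := by
      rw [hw, Complex.norm_real, Real.norm_of_nonneg (by linarith)]
    have hfix : (f c)^[m] w = w := by
      have := hz (Set.mem_univ w)
      simpa [sub_eq_zero] using this
    obtain ⟨n, rfl⟩ := Nat.exists_eq_succ_of_ne_zero (Nat.one_le_iff_ne_zero.1 hm)
    rw [Function.iterate_succ_apply] at hfix
    have key : ∀ n y, escapeRadius c ≤ ‖y‖ → ‖y‖ ≤ ‖(f c)^[n] y‖ := by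
      intro n y hy
      induction n with
      | zero => simp
      | succ n ih =>
        rw [Function.iterate_succ_apply']
        have := two_mul_le_norm_f (escapeRadius_le_norm_iterate_f hy n)
        have := norm_nonneg y
        linarith
    have h1 : escapeRadius c ≤ ‖w‖ := by linarith
    have h2 := two_mul_le_norm_f h1
    have h3 := key n _ (escapeRadius_le_norm_f h1)
    rw [hfix] at h3
    linarith
  · filter_upwards [h] with w hw hww
    rw [hww, sub_self] at hw
    exact hw rfl

theorem not_tendsto_of_repelling {F : ℂ → ℂ} {p z : ℂ} (hF : DifferentiableAt ℂ F p)
    (hp : F p = p) (hgt : 1 < ‖deriv F p‖) (hne : ∀ k, F^[k] z ≠ p) :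
    ¬ Tendsto (fun k => F^[k] z) atTop (𝓝 p) := by
  intro ht
  have ho := (hasDerivAt_iff_isLittleO.1 hF.hasDerivAt).def (sub_pos.2 hgt)
  obtain ⟨N, hN⟩ := eventually_atTop.1 (ht.eventually ho)
  have hmono : ∀ k, N ≤ k → ‖F^[N] z - p‖ ≤ ‖F^[k] z - p‖ := by
    intro k hk
    induction k, hk using Nat.le_induction with
    | base => exact le_rfl
    | succ k hk ih =>
      refine ih.trans ?_
      have h1 := hN k hk
      rw [hp, smul_eq_mul, ← Function.iterate_succ_apply' F] at h1
      set x := F^[k] z - p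
      have h2 : x * deriv F p = (F^[k + 1] z - p) - (F^[k + 1] z - p - x * deriv F p) := by ring
      have h3 := norm_sub_le (F^[k + 1] z - p) (F^[k + 1] z - p - x * deriv F p)
      rw [← h2, norm_mul] at h3
      nlinarith
  have h0 : 0 < ‖F^[N] z - p‖ := norm_pos_iff.2 (sub_ne_zero.2 (hne N))
  obtain ⟨k, hk1, hk2⟩ := ((eventually_ge_atTop N).and
    (ht.eventually (ball_mem_nhds p h0))).exists
  rw [dist_eq_norm] at hk2
  exact absurd (hmono k hk1) (not_le.2 hk2)

theorem escapingAlong_periodic_false {U : Filter ℂ} [U.NeBot] {c₀ z : ℂ} {m : ℕ} (hU : U ≤ 𝓝 c₀)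
    (hP : c₀ ∉ P) (hzO : z ∈ escapingAlong U) (hzK : z ∈ interior (K c₀)) (hm : 1 ≤ m)
    (hper : interiorComponent c₀ ((f c₀)^[m] z) = interiorComponent c₀ z) : False := by
  set V := interiorComponent c₀ z with hVdef
  have hV : IsOpen V := isOpen_interiorComponent c₀ z
  have hVc : IsPreconnected V := isPreconnected_interiorComponent c₀ z
  have hzV : z ∈ V := mem_interiorComponent hzK
  have hVK : V ⊆ K c₀ := interiorComponent_subset_K c₀ z
  set F := (f c₀)^[m] with hFdef
  have hFd : Differentiable ℂ F := differentiable_iterate_f c₀ m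
  have hFk : ∀ k, F^[k] = (f c₀)^[m * k] := fun k => (Function.iterate_mul _ _ _).symm
  have hFV : ∀ w ∈ V, F w ∈ V := by
    intro w hw
    have := iterate_f_mem_interiorComponent hw m
    rwa [hper] at this
  have hit : ∀ k : ℕ, ∀ w ∈ V, F^[k] w ∈ V := by
    intro k
    induction k with
    | zero => intro w hw; simpa
    | succ k ih => intro w hw; rw [Function.iterate_succ_apply']; exact hFV _ (ih w hw)
  have hlimit : ∀ 𝓥 : Ultrafilter ℕ, (𝓥 : Filter ℕ) ≤ atTop → ∃ ζ : ℂ, F ζ = ζ ∧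
      TendstoLocallyUniformlyOn (fun k => F^[k]) (fun _ => ζ) 𝓥 V := by
    intro 𝓥 h𝓥
    obtain ⟨g, hgd, hg⟩ := exists_limit_along_ultrafilter 𝓥 hV (h := fun k => F^[k])
      (fun k => (hFd.iterate k).differentiableOn) (fun w _ =>
        ⟨1, one_pos, escapeRadius c₀, Eventually.of_forall fun k y hy =>
          norm_le_of_mem_K (hVK (hit k y hy.2))⟩)
    have hconst : ∀ᶠ w in 𝓝 z, g w = g z := by
      by_contra hnc
      obtain ⟨ε, hε, hεO⟩ := Metric.isOpen_iff.1 (isOpen_escapingAlong U) z hzO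
      obtain ⟨k, w, hw, hk⟩ := (eventually_exists_eq_of_tendstoLocallyUniformlyOn hV
        (h := fun k => F^[k]) (fun k => (hFd.iterate k).differentiableOn) hgd hg hzV hnc hε).exists
      have hy0 : g z ∈ escapingAlong U := by
        rw [← hk, hFk]
        exact iterate_f_mem_escapingAlong hU (hεO hw.1) _
      obtain ⟨r, hr, hrd⟩ := hy0
      have hev : ∀ᶠ k in (𝓥 : Filter ℕ), F^[k] z ∈ ball (g z) (r / 6) :=
        (hg.tendsto_at hzV).eventually (ball_mem_nhds _ (by positivity))
      obtain ⟨k₁, hk₁⟩ := hev.exists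
      obtain ⟨k₂, hk₂, hk₁₂⟩ := (hev.and (h𝓥 (eventually_ge_atTop (k₁ + 3)))).exists
      obtain ⟨d, rfl⟩ := Nat.exists_eq_add_of_le hk₁₂
      refine no_recurrence hU hrd (m := m * (3 + d)) ?_ hk₁ ?_
      · nlinarith
      · rw [hFk, ← Function.iterate_add_apply, ← mul_add, ← hFk]
        convert hk₂ using 2
        ring_nf
    have hgz : ∀ w ∈ V, g w = g z := fun w hw =>
      (hgd.analyticOnNhd hV).eqOn_of_preconnected_of_eventuallyEq analyticOnNhd_const hVc hzV
        hconst hw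
    refine ⟨g z, ?_, hg.congr_right hgz⟩
    have h1 : Tendsto (fun k => F (F^[k] z)) 𝓥 (𝓝 (F (g z))) :=
      (hFd.continuous.tendsto _).comp (hg.tendsto_at hzV)
    have h2 : Tendsto (fun k => F (F^[k] z)) 𝓥 (𝓝 (g z)) := by
      rw [← hgz _ (hFV z hzV)]
      refine (hg.tendsto_at (hFV z hzV)).congr fun k => ?_
      rw [← Function.iterate_succ_apply, Function.iterate_succ_apply']
    exact tendsto_nhds_unique h1 h2
  obtain ⟨p, hp, hp𝓥⟩ := hlimit (Ultrafilter.of atTop) (Ultrafilter.of_le _)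
  have hiso := isolated_fixed_point c₀ p hm
  rw [eventually_nhdsWithin_iff, Metric.eventually_nhds_iff_ball] at hiso
  obtain ⟨ρ₀, hρ₀, hiso⟩ := hiso
  have hconvz : Tendsto (fun k => F^[k] z) atTop (𝓝 p) := by
    rw [Metric.tendsto_nhds]
    intro ε hε
    by_contra hne
    set ρ := min ε (ρ₀ / 2) with hρ
    have hρ0 : 0 < ρ := lt_min hε (by positivity)
    have h1 : ∃ᶠ k in atTop, k ∈ {k | F^[k] z ∈ ball p ρ} := by
      have := (hp𝓥.tendsto_at hzV).eventually (ball_mem_nhds p hρ0)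
      exact this.frequently.filter_mono (Ultrafilter.of_le _)
    have h2 : ∃ᶠ k in atTop, k ∉ {k | F^[k] z ∈ ball p ρ} := by
      refine (not_eventually.1 hne).mono fun k hk hk' => hk ?_
      exact (mem_ball.1 hk').trans_le (min_le_left _ _)
    have h3 := frequently_exit h1 h2
    have : NeBot (atTop ⊓ 𝓟 {k | k ∈ {k | F^[k] z ∈ ball p ρ} ∧ k + 1 ∉ {k | F^[k] z ∈ ball p ρ}}) :=
      frequently_mem_iff_neBot.1 h3
    set 𝓦 := Ultrafilter.of
      (atTop ⊓ 𝓟 {k | k ∈ {k | F^[k] z ∈ ball p ρ} ∧ k + 1 ∉ {k | F^[k] z ∈ ball p ρ}}) with h𝓦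
    have h𝓦le := Ultrafilter.of_le
      (atTop ⊓ 𝓟 {k | k ∈ {k | F^[k] z ∈ ball p ρ} ∧ k + 1 ∉ {k | F^[k] z ∈ ball p ρ}})
    have h𝓦mem := h𝓦le.trans inf_le_right (mem_principal_self _)
    obtain ⟨ζ, hζ, hζ𝓦⟩ := hlimit 𝓦 (h𝓦le.trans inf_le_left)
    have hζt := hζ𝓦.tendsto_at hzV
    have hζb : ζ ∈ closedBall p ρ := by
      refine isClosed_closedBall.mem_of_tendsto hζt ?_
      filter_upwards [h𝓦mem] with k hk using ball_subset_closedBall hk.1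
    have hζp : ζ = p := by
      by_contra hne
      refine hiso ζ (closedBall_subset_ball ?_ hζb) hne hζ
      have : ρ ≤ ρ₀ / 2 := min_le_right _ _
      linarith
    have hnext : Tendsto (fun k => F^[k + 1] z) 𝓦 (𝓝 p) := by
      simp only [Function.iterate_succ_apply']
      rw [← hp]
      rw [hζp] at hζt
      exact (hFd.continuous.tendsto p).comp hζt
    obtain ⟨k, hk1, hk2⟩ := ((hnext.eventually (ball_mem_nhds p hρ0)).and h𝓦mem).exists
    exact hk2.2 hk1
  have hconvU : ∀ 𝓥 : Ultrafilter ℕ, (𝓥 : Filter ℕ) ≤ atTop →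
      TendstoLocallyUniformlyOn (fun k => F^[k]) (fun _ => p) 𝓥 V := by
    intro 𝓥 h𝓥
    obtain ⟨ζ, hζ, hζ𝓥⟩ := hlimit 𝓥 h𝓥
    have : ζ = p := tendsto_nhds_unique (hζ𝓥.tendsto_at hzV) (hconvz.mono_left h𝓥)
    rwa [this] at hζ𝓥
  have hconv : ∀ w ∈ V, Tendsto (fun k => F^[k] w) atTop (𝓝 p) := by
    intro w hw
    rw [tendsto_iff_ultrafilter]
    intro 𝓥 h𝓥
    exact (hconvU 𝓥 h𝓥).tendsto_at hw
  have hroot : ¬ IsRootOfUnity (deriv F p) := fun h => hP ⟨m, hm, p, hp, h⟩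
  have hne1 : deriv F p ≠ 1 := by
    intro h
    exact hroot ⟨1, le_rfl, by rw [h]; simp⟩
  by_cases hlt : ‖deriv F p‖ < 1
  · obtain ⟨ε, hε, hεK⟩ := exists_ball_subset_K_of_attracting hm hp hlt
    obtain ⟨k, hk⟩ := (hconvz.eventually (ball_mem_nhds p hε)).exists
    have hkO : F^[k] z ∈ escapingAlong U := by
      rw [hFk]
      exact iterate_f_mem_escapingAlong hU hzO _
    obtain ⟨r, hr, hrd⟩ := hkO
    obtain ⟨c, hc1, hc2⟩ := (hrd.and (hU hεK)).exists
    exact Set.disjoint_left.1 hc1 (mem_ball_self hr) (hc2 hk)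
  push Not at hlt
  have hpV : p ∉ V := by
    intro hpV
    have h1 := ((hconvU (Ultrafilter.of atTop) (Ultrafilter.of_le _)).deriv
      (Eventually.of_forall fun k => (hFd.iterate k).differentiableOn) hV).tendsto_at hpV
    simp only [deriv_const, Function.comp] at h1
    obtain ⟨k, hk⟩ := (h1.eventually (ball_mem_nhds 0 one_pos)).exists
    rw [dist_zero_right, (HasDerivAt.iterate p (hFd p).hasDerivAt hp k).deriv, norm_pow] at hk
    exact absurd (one_le_pow₀ hlt) (not_le.2 hk)
  rcases hlt.eq_or_lt with heq | hgt
  · obtain ⟨l, hl, he⟩ := exists_log_on_interiorComponent hpV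
    exact snail_lemma hV hVc hl he hFd hFV hconv hp heq.symm hne1 hzV
  · exact not_tendsto_of_repelling (hFd p) hp hgt
      (fun k h => hpV (h ▸ hit k z hzV)) hconvz

open MeasureTheory in
theorem integrableOn_inv_ball (R : ℝ) :
    IntegrableOn (fun z : ℂ => z⁻¹) (ball 0 R) := by
  refine ⟨measurable_inv.aestronglyMeasurable, ?_⟩
  rw [hasFiniteIntegral_iff_norm, ← lintegral_indicator measurableSet_ball,
    ← Complex.lintegral_comp_polarCoord_symm]
  have hle : ∀ p ∈ polarCoord.target, ENNReal.ofReal p.1 •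
      (ball (0 : ℂ) R).indicator (fun z => ENNReal.ofReal ‖z⁻¹‖) (Complex.polarCoord.symm p) ≤
      (Set.Ioo 0 R ×ˢ Set.Ioo (-Real.pi) Real.pi).indicator (fun _ => 1) p := by
    rintro ⟨r, θ⟩ hp
    rw [polarCoord_target] at hp
    obtain ⟨hr, hθ⟩ := hp
    have hr : 0 < r := hr
    have hn : ‖Complex.polarCoord.symm (r, θ)‖ = r := by
      rw [Complex.norm_polarCoord_symm, abs_of_pos hr]
    by_cases h : r < R
    · rw [Set.indicator_of_mem (by rwa [mem_ball_zero_iff, hn]),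
        Set.indicator_of_mem (Set.mk_mem_prod (Set.mem_Ioo.2 ⟨hr, h⟩) hθ),
        norm_inv, hn, smul_eq_mul, ← ENNReal.ofReal_mul hr.le, mul_inv_cancel₀ hr.ne']
      simp
    · rw [Set.indicator_of_notMem (by rwa [mem_ball_zero_iff, hn])]
      simp
  have hms : MeasurableSet polarCoord.target := polarCoord.open_target.measurableSet
  refine (setLIntegral_mono_ae' hms (Eventually.of_forall hle)).trans_lt ?_
  refine (setLIntegral_le_lintegral _ _).trans_lt ?_
  rw [lintegral_indicator (measurableSet_Ioo.prod measurableSet_Ioo), setLIntegral_one,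
    Measure.volume_eq_prod, Measure.prod_prod]
  simp [ENNReal.mul_lt_top]

/-- `g` is a bounded measurable function vanishing outside `closedBall 0 R`. -/
structure IsBoundedDensity (g : ℂ → ℂ) (B R : ℝ) : Prop where
  aestronglyMeasurable : MeasureTheory.AEStronglyMeasurable g MeasureTheory.volume
  norm_le : ∀ ζ, ‖g ζ‖ ≤ B
  eq_zero : ∀ ζ, R < ‖ζ‖ → g ζ = 0

/-- The (unnormalised) Cauchy transform of a density on the plane. -/
def cauchyTransform (g : ℂ → ℂ) (z : ℂ) : ℂ :=
  ∫ ζ, g ζ * (ζ - z)⁻¹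

namespace IsBoundedDensity

variable {g : ℂ → ℂ} {B R : ℝ}

open MeasureTheory

theorem integrable (hg : IsBoundedDensity g B R) : Integrable g := by
  have h : IntegrableOn g (closedBall 0 R) :=
    Measure.integrableOn_of_bounded (M := B) measure_closedBall_lt_top.ne hg.aestronglyMeasurable
      (Eventually.of_forall hg.norm_le)
  rw [← integrable_indicator_iff measurableSet_closedBall] at h
  refine h.congr (Eventually.of_forall fun ζ => ?_)
  by_cases hζ : ζ ∈ closedBall (0 : ℂ) R
  · simp [Set.indicator_of_mem hζ]
  · rw [Set.indicator_of_notMem hζ, hg.eq_zero ζ (by simpa using hζ)]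

theorem indicator (hg : IsBoundedDensity g B R) {s : Set ℂ} (hs : MeasurableSet s) :
    IsBoundedDensity (s.indicator g) B R where
  aestronglyMeasurable := hg.aestronglyMeasurable.indicator hs
  norm_le ζ := (norm_indicator_le_norm_self _ _).trans (hg.norm_le ζ)
  eq_zero ζ hζ := by
    by_cases h : ζ ∈ s
    · rw [Set.indicator_of_mem h, hg.eq_zero ζ hζ]
    · rw [Set.indicator_of_notMem h]

theorem mul_inv_sub_eq_mul_indicator (hg : IsBoundedDensity g B R) {ρ : ℝ} {z : ℂ}
    (hρ : R + ‖z‖ < ρ) (ζ : ℂ) :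
    g ζ * (ζ - z)⁻¹ = g ζ * (ball (0 : ℂ) ρ).indicator (fun z => z⁻¹) (ζ - z) := by
  by_cases h : ζ - z ∈ ball (0 : ℂ) ρ
  · rw [Set.indicator_of_mem h]
  · rw [Set.indicator_of_notMem h, hg.eq_zero ζ, zero_mul, zero_mul]
    have h1 : ρ ≤ ‖ζ - z‖ := by simpa using h
    have h2 := norm_sub_le ζ z
    linarith

theorem integrable_mul (hg : IsBoundedDensity g B R) {h : ℂ → ℂ} (hh : Integrable h) :
    Integrable (fun ζ => g ζ * h ζ) :=
  hh.bdd_mul hg.aestronglyMeasurable (Eventually.of_forall hg.norm_le)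

theorem integrable_mul_inv_sub (hg : IsBoundedDensity g B R) (z : ℂ) :
    Integrable (fun ζ => g ζ * (ζ - z)⁻¹) := by
  have h := (integrableOn_inv_ball (R + ‖z‖ + 1)).integrable_indicator measurableSet_ball
  exact (hg.integrable_mul (h.comp_sub_right z)).congr
    (Eventually.of_forall fun ζ => (hg.mul_inv_sub_eq_mul_indicator (by linarith) ζ).symm)

theorem continuous_integral_mul_sub (hg : IsBoundedDensity g B R) {h : ℂ → ℂ}
    (hh : Integrable h) : Continuous fun z => ∫ ζ, g ζ * h (ζ - z) := by
  have hB : 0 ≤ B := (norm_nonneg _).trans (hg.norm_le 0)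
  refine continuous_of_uniform_approx_of_continuous fun u hu => ?_
  obtain ⟨ε, hε, hεu⟩ := Metric.mem_uniformity_dist.1 hu
  obtain ⟨φ, hφs, hφ, hφc, hφi⟩ :=
    hh.exists_hasCompactSupport_integral_sub_le (ε := ε / (2 * (B + 1))) (by positivity)
  obtain ⟨C, hC⟩ := hφc.bounded_above_of_compact_support hφs
  refine ⟨fun z => ∫ ζ, g ζ * φ (ζ - z), ?_, fun z => hεu ?_⟩
  · refine continuous_of_dominated (bound := fun ζ => ‖g ζ‖ * C)
      (fun z => hg.aestronglyMeasurable.mul (by fun_prop)) (fun z => ?_)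
      (hg.integrable.norm.mul_const _) (Eventually.of_forall fun ζ => by fun_prop)
    refine Eventually.of_forall fun ζ => ?_
    rw [norm_mul]
    exact mul_le_mul_of_nonneg_left (hC _) (norm_nonneg _)
  · rw [dist_eq_norm, ← integral_sub (hg.integrable_mul (hh.comp_sub_right z))
      (hg.integrable_mul (hφi.comp_sub_right z))]
    have h1 : Integrable fun ζ => B * ‖h (ζ - z) - φ (ζ - z)‖ :=
      ((hh.sub hφi).comp_sub_right z).norm.const_mul B
    refine (norm_integral_le_of_norm_le h1 (Eventually.of_forall fun ζ => ?_)).trans_lt ?_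
    · rw [← mul_sub, norm_mul]
      exact mul_le_mul_of_nonneg_right (hg.norm_le ζ) (norm_nonneg _)
    · rw [integral_const_mul, integral_sub_right_eq_self (fun ζ => ‖h ζ - φ ζ‖) z]
      calc B * ∫ ζ, ‖h ζ - φ ζ‖ ≤ (B + 1) * (ε / (2 * (B + 1))) := by
            gcongr
            · linarith
        _ = ε / 2 := by field_simp
        _ < ε := by linarith

theorem continuous_cauchyTransform (hg : IsBoundedDensity g B R) :
    Continuous (cauchyTransform g) := by
  rw [continuous_iff_continuousAt]
  intro z₀
  have h := (integrableOn_inv_ball (R + ‖z₀‖ + 1)).integrable_indicator measurableSet_ball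
  refine (hg.continuous_integral_mul_sub h).continuousAt.congr ?_
  have : ∀ᶠ z in 𝓝 z₀, ‖z‖ < ‖z₀‖ + 1 := continuous_norm.continuousAt.eventually_lt
    continuousAt_const (by simp)
  filter_upwards [this] with z hz
  refine integral_congr_ae (Eventually.of_forall fun ζ => ?_)
  exact (hg.mul_inv_sub_eq_mul_indicator (by linarith) ζ).symm

theorem tendsto_cauchyTransform_cocompact (hg : IsBoundedDensity g B R) :
    Tendsto (cauchyTransform g) (cocompact ℂ) (𝓝 0) := by
  have h1 : Tendsto (fun z : ℂ => (∫ ζ, ‖g ζ‖) * (‖z‖ - R)⁻¹) (cocompact ℂ) (𝓝 0) := by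
    have : Tendsto (fun z : ℂ => ‖z‖ - R) (cocompact ℂ) atTop :=
      tendsto_atTop_add_const_right _ _ (tendsto_norm_cocompact_atTop)
    simpa using this.inv_tendsto_atTop.const_mul (∫ ζ, ‖g ζ‖)
  refine squeeze_zero_norm' ?_ h1
  have h2 : ∀ᶠ z : ℂ in cocompact ℂ, R < ‖z‖ :=
    (tendsto_norm_cocompact_atTop).eventually_gt_atTop R
  filter_upwards [h2] with z hz
  rw [cauchyTransform, ← integral_mul_const]
  refine norm_integral_le_of_norm_le (hg.integrable.norm.mul_const _)
    (Eventually.of_forall fun ζ => ?_)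
  rw [norm_mul]
  by_cases hζ : R < ‖ζ‖
  · simp [hg.eq_zero ζ hζ]
  · refine mul_le_mul_of_nonneg_left ?_ (norm_nonneg _)
    rw [norm_inv]
    refine inv_anti₀ (by linarith) ?_
    have := norm_sub_norm_le z ζ
    rw [norm_sub_rev] at this
    push Not at hζ
    linarith

theorem differentiableOn_cauchyTransform (hg : IsBoundedDensity g B R) {O : Set ℂ}
    (hO : IsOpen O) (h0 : ∀ ζ ∈ O, g ζ = 0) : DifferentiableOn ℂ (cauchyTransform g) O := by
  intro z₀ hz₀
  obtain ⟨δ, hδ, hball⟩ := Metric.isOpen_iff.1 hO z₀ hz₀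
  have key := hasDerivAt_integral_of_dominated_loc_of_deriv_le (μ := volume)
    (F := fun z ζ => g ζ * (ζ - z)⁻¹) (F' := fun z ζ => g ζ * ((ζ - z) ^ 2)⁻¹) (x₀ := z₀)
    (s := ball z₀ (δ / 2)) (bound := fun ζ => ‖g ζ‖ * ((δ / 2) ^ 2)⁻¹)
    (ball_mem_nhds _ (by positivity))
    (Eventually.of_forall fun z => (hg.integrable_mul_inv_sub z).aestronglyMeasurable)
    (hg.integrable_mul_inv_sub z₀)
    (hg.aestronglyMeasurable.mul (by
      refine Measurable.aestronglyMeasurable ?_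
      fun_prop))
    ?_ (hg.integrable.norm.mul_const _) ?_
  · exact key.2.differentiableAt.differentiableWithinAt
  all_goals
    refine Eventually.of_forall fun ζ z hz => ?_
    by_cases hζ : ζ ∈ ball z₀ δ
    · simp [h0 ζ (hball hζ), hasDerivAt_const]
    have hle : δ / 2 ≤ ‖ζ - z‖ := by
      rw [mem_ball, dist_eq_norm] at hζ hz
      have := norm_add_le (ζ - z) (z - z₀)
      rw [sub_add_sub_cancel] at this
      linarith
  · rw [norm_mul, norm_inv, norm_pow]
    gcongr
  · have hne : ζ - z ≠ 0 := by
      intro h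
      rw [h, norm_zero] at hle
      linarith
    have := (((hasDerivAt_id z).const_sub ζ).inv hne).const_mul (g ζ)
    simpa using this

end IsBoundedDensity

theorem volume_im_eq (t : ℝ) : MeasureTheory.volume {z : ℂ | z.im = t} = 0 := by
  have h := Complex.volume_preserving_equiv_real_prod.measure_preimage_equiv (Set.univ ×ˢ {t})
  have h2 : Complex.measurableEquivRealProd ⁻¹' (Set.univ ×ˢ {t}) = {z : ℂ | z.im = t} := by
    ext z
    simp [Complex.measurableEquivRealProd_apply]
  rw [← h2, h, MeasureTheory.Measure.volume_eq_prod, MeasureTheory.Measure.prod_prod]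
  simp

theorem volume_re_eq (t : ℝ) : MeasureTheory.volume {z : ℂ | z.re = t} = 0 := by
  have h := Complex.volume_preserving_equiv_real_prod.measure_preimage_equiv ({t} ×ˢ Set.univ)
  have h2 : Complex.measurableEquivRealProd ⁻¹' ({t} ×ˢ Set.univ) = {z : ℂ | z.re = t} := by
    ext z
    simp [Complex.measurableEquivRealProd_apply]
  rw [← h2, h, MeasureTheory.Measure.volume_eq_prod, MeasureTheory.Measure.prod_prod]
  simp

theorem exists_re_pos_f_eq {c z : ℂ} (hz : z.im ≠ c.im) : ∃ w : ℂ, 0 < w.re ∧ f c w = z := by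
  obtain ⟨s, hs⟩ := IsAlgClosed.exists_pow_nat_eq (z - c) (n := 2) (by norm_num)
  have hre : s.re ≠ 0 := by
    intro h
    apply hz
    have := congrArg Complex.im hs
    simp [pow_two, h] at this
    linarith
  rcases lt_or_gt_of_ne hre with h | h
  · exact ⟨-s, by simpa using h, by simp [f, hs]⟩
  · exact ⟨s, h, by simp [f, hs]⟩

theorem injOn_f_re_pos (c : ℂ) : Set.InjOn (f c) {w | 0 < w.re} := by
  intro x hx y hy h
  have h1 : x ^ 2 = y ^ 2 := by simpa [f] using h
  rcases sq_eq_sq_iff_eq_or_eq_neg.1 h1 with h2 | h2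
  · exact h2
  · have hx : 0 < x.re := hx
    have hy : 0 < y.re := hy
    rw [h2, Complex.neg_re] at hx
    linarith

open MeasureTheory in
theorem setIntegral_comp_f_re_pos (c : ℂ) (φ : ℂ → ℂ) :
    ∫ w in {w : ℂ | 0 < w.re}, ‖2 * w‖ ^ 2 • φ (f c w) = ∫ z, φ z := by
  have hms : MeasurableSet {w : ℂ | 0 < w.re} :=
    (isOpen_lt continuous_const Complex.continuous_re).measurableSet
  have hd : ∀ w ∈ {w : ℂ | 0 < w.re}, HasFDerivWithinAt (f c)
      (ContinuousLinearMap.mul ℝ ℂ (2 * w)) {w : ℂ | 0 < w.re} w := by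
    intro w _
    have h1 : HasDerivAt (f c) (2 * w) w := by
      have h0 : HasDerivAt (fun z : ℂ => z ^ 2) (2 * w) w := by
        simpa using hasDerivAt_pow 2 w
      exact h0.add_const c
    have h2 := (h1.hasFDerivAt.restrictScalars ℝ).hasFDerivWithinAt (s := {w : ℂ | 0 < w.re})
    have h3 : (ContinuousLinearMap.mul ℝ ℂ) (2 * w) =
        ContinuousLinearMap.restrictScalars ℝ (ContinuousLinearMap.toSpanSingleton ℂ (2 * w)) := by
      ext
      simp [mul_comm]
    rw [h3]
    exact h2
  have h := integral_image_eq_integral_abs_det_fderiv_smul volume hms hd (injOn_f_re_pos c) φ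
  have hdet : ∀ w : ℂ, |(ContinuousLinearMap.mul ℝ ℂ (2 * w)).det| = ‖2 * w‖ ^ 2 := by
    intro w
    have h3 : (ContinuousLinearMap.mul ℝ ℂ (2 * w)).det = Algebra.norm ℝ (2 * w) := by
      rw [Algebra.norm_apply]
      rfl
    rw [h3, Algebra.norm_complex_apply, abs_of_nonneg (Complex.normSq_nonneg _),
      Complex.normSq_eq_norm_sq]
  simp only [hdet] at h
  rw [← h, ← setIntegral_univ (μ := volume) (f := φ)]
  refine setIntegral_congr_set ?_
  have : ∀ᵐ z : ℂ, z.im ≠ c.im := by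
    rw [ae_iff]
    simpa using volume_im_eq c.im
  filter_upwards [this] with z hz
  refine propext ⟨fun _ => trivial, fun _ => ?_⟩
  obtain ⟨w, hw, hw'⟩ := exists_re_pos_f_eq hz
  exact ⟨w, hw, hw'⟩

open MeasureTheory in
theorem integral_comp_f (c : ℂ) (φ : ℂ → ℂ)
    (hi : Integrable fun w : ℂ => ‖2 * w‖ ^ 2 • φ (f c w)) :
    ∫ w : ℂ, ‖2 * w‖ ^ 2 • φ (f c w) = 2 * ∫ z, φ z := by
  have hms : MeasurableSet {w : ℂ | 0 < w.re} :=
    (isOpen_lt continuous_const Complex.continuous_re).measurableSet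
  rw [← integral_add_compl hms hi, setIntegral_comp_f_re_pos, two_mul]
  congr 1
  rw [← setIntegral_comp_f_re_pos c φ, ← integral_indicator hms, ← integral_indicator hms.compl,
    ← integral_neg_eq_self]
  refine integral_congr_ae ?_
  have : ∀ᵐ z : ℂ, z.re ≠ 0 := by
    rw [ae_iff]
    simpa using volume_re_eq 0
  filter_upwards [this] with z hz
  by_cases h : 0 < z.re
  · rw [Set.indicator_of_mem (show z ∈ {w : ℂ | 0 < w.re} from h), Set.indicator_of_mem]
    · simp [f_neg]
    · show ¬ 0 < (-z).re
      simp [h.le]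
  · rw [Set.indicator_of_notMem (show z ∉ {w : ℂ | 0 < w.re} from h), Set.indicator_of_notMem]
    show ¬ ¬ 0 < (-z).re
    rw [not_not, Complex.neg_re]
    push Not at h
    exact neg_pos.2 (lt_of_le_of_ne h hz)

open MeasureTheory ComplexConjugate in
theorem cauchyTransform_f {g : ℂ → ℂ} {B R : ℝ} {c : ℂ} (hg : IsBoundedDensity g B R)
    (hinv : ∀ ζ, ζ ≠ 0 → g ζ * ζ = g (f c ζ) * conj ζ) (z : ℂ) :
    cauchyTransform g (f c z) = 2 * z * cauchyTransform g z + cauchyTransform g c := by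
  have hae : ∀ a : ℂ, ∀ᵐ w : ℂ, w ≠ a := fun a => by
    rw [ae_iff]
    simp
  have heven : ∀ ζ, ζ ≠ 0 → g (-ζ) = g ζ := by
    intro ζ hζ
    have h1 := hinv ζ hζ
    have h2 := hinv (-ζ) (neg_ne_zero.2 hζ)
    rw [f_neg, map_neg] at h2
    refine mul_right_cancel₀ hζ ?_
    linear_combination -h2 - h1
  have hodd : ∀ z, cauchyTransform g (-z) = - cauchyTransform g z := by
    intro z
    rw [cauchyTransform, cauchyTransform, ← integral_neg_eq_self, ← integral_neg]
    refine integral_congr_ae ?_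
    filter_upwards [hae 0] with w hw
    rw [heven w hw, ← mul_neg, ← inv_neg]
    congr 2
    ring
  have main : ∀ z, cauchyTransform g (f c z) = 2 * (∫ w, g w) + 2 * z * cauchyTransform g z := by
    intro z
    have h1 : Integrable fun w => 4 * g w + (2 * z * (g w * (w - z)⁻¹) -
        2 * z * (g w * (w - -z)⁻¹)) :=
      (hg.integrable.const_mul 4).add (((hg.integrable_mul_inv_sub z).const_mul _).sub
        ((hg.integrable_mul_inv_sub (-z)).const_mul _))
    have h2 : (fun w => 4 * g w + (2 * z * (g w * (w - z)⁻¹) -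
        2 * z * (g w * (w - -z)⁻¹))) =ᵐ[volume]
        fun w => ‖2 * w‖ ^ 2 • (g (f c w) * (f c w - f c z)⁻¹) := by
      filter_upwards [hae 0, hae z, hae (-z)] with w hw hwz hwz'
      have e1 : ((‖2 * w‖ ^ 2 : ℝ) : ℂ) = 4 * w * conj w := by
        rw [Complex.ofReal_pow, ← Complex.mul_conj']
        rw [map_mul, Complex.conj_ofNat]
        ring
      have e2 : f c w - f c z = (w - z) * (w - -z) := by
        simp only [f]
        ring
      have h3 : w - z ≠ 0 := sub_ne_zero.2 hwz
      have h4 : w - -z ≠ 0 := sub_ne_zero.2 hwz'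
      rw [Complex.real_smul, e1, e2]
      have h5 : 4 * w * conj w * (g (f c w) * ((w - z) * (w - -z))⁻¹) =
          4 * w * (g w * w) * ((w - z) * (w - -z))⁻¹ := by
        rw [hinv w hw]
        ring
      rw [h5]
      field_simp
      ring
    have h3 := integral_comp_f c (fun ζ => g ζ * (ζ - f c z)⁻¹) (h1.congr h2)
    have h5 : Integrable fun w => 2 * z * (g w * (w - z)⁻¹) - 2 * z * (g w * (w - -z)⁻¹) :=
      ((hg.integrable_mul_inv_sub z).const_mul _).sub
        ((hg.integrable_mul_inv_sub (-z)).const_mul _)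
    rw [← integral_congr_ae h2, integral_add (hg.integrable.const_mul 4) h5,
      integral_sub ((hg.integrable_mul_inv_sub z).const_mul _)
        ((hg.integrable_mul_inv_sub (-z)).const_mul _), integral_const_mul, integral_const_mul,
      integral_const_mul] at h3
    have h4 := hodd z
    simp only [cauchyTransform] at h4 ⊢
    rw [h4] at h3
    linear_combination -h3 / 2
  have h0 := main 0
  have hc : f c 0 = c := by simp [f]
  rw [hc] at h0
  rw [main z, h0]
  ring

open ComplexConjugate in
theorem cauchyTransform_eq_zero_of_notMem_K {g : ℂ → ℂ} {B R : ℝ} {c : ℂ} (hc : c ∈ M)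
    (hg : IsBoundedDensity g B R)
    (hinv : ∀ ζ, ζ ≠ 0 → g ζ * ζ = g (f c ζ) * conj ζ) (hv : cauchyTransform g c = 0)
    {z : ℂ} (hz : z ∉ K c) : cauchyTransform g z = 0 := by
  have hfe : ∀ z, ‖cauchyTransform g (f c z)‖ = 2 * ‖z‖ * ‖cauchyTransform g z‖ := by
    intro z
    rw [cauchyTransform_f hg hinv, hv, add_zero, norm_mul, norm_mul, Complex.norm_two]
  have hlarge : ∀ w, escapeRadius c < ‖w‖ → cauchyTransform g w = 0 := by
    intro w hw
    have hn : ∀ n : ℕ, 2 ^ n * 4 ≤ ‖(f c)^[n] w‖ := by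
      intro n
      induction n with
      | zero => simpa using (four_le_escapeRadius c).trans hw.le
      | succ n ih =>
        rw [Function.iterate_succ_apply', pow_succ]
        have := two_mul_le_norm_f (escapeRadius_le_norm_iterate_f hw.le n)
        linarith
    have hge : ∀ n : ℕ, ‖cauchyTransform g w‖ ≤ ‖cauchyTransform g ((f c)^[n] w)‖ := by
      intro n
      induction n with
      | zero => simp
      | succ n ih =>
        rw [Function.iterate_succ_apply', hfe]
        have h4 := (four_le_escapeRadius c).trans (escapeRadius_le_norm_iterate_f hw.le n)
        nlinarith [norm_nonneg (cauchyTransform g ((f c)^[n] w))]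
    have ht : Tendsto (fun n : ℕ => (f c)^[n] w) atTop (cocompact ℂ) := by
      rw [← cobounded_eq_cocompact, ← tendsto_norm_atTop_iff_cobounded]
      refine tendsto_atTop_mono hn ?_
      exact (tendsto_pow_atTop_atTop_of_one_lt one_lt_two).atTop_mul_const (by norm_num)
    have ht2 := (hg.tendsto_cauchyTransform_cocompact.comp ht).norm
    rw [norm_zero] at ht2
    have := ge_of_tendsto' ht2 hge
    simpa using this
  obtain ⟨n, hn⟩ := exists_iterate_large_of_notMem_K hz
  have h0 := hlarge _ hn
  have hback : ∀ (n : ℕ) (z : ℂ), z ∉ K c → cauchyTransform g ((f c)^[n] z) = 0 →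
      cauchyTransform g z = 0 := by
    intro n
    induction n with
    | zero => exact fun z _ h => h
    | succ n ih =>
      intro z hz h
      have h1 := ih (f c z) (fun h => hz (f_mem_K_iff.1 h)) h
      have h2 := hfe z
      have hz0 : z ≠ 0 := by
        rintro rfl
        exact hz (zero_mem_K hc)
      rw [h1, norm_zero, eq_comm, mul_eq_zero] at h2
      rcases h2 with h2 | h2
      · exact absurd h2 (by simpa using hz0)
      · simpa using h2
  exact hback n z hz h0

open ComplexConjugate in
theorem cauchyTransform_eq_zero_of_notMem_interior_K {g : ℂ → ℂ} {B R : ℝ} {c : ℂ} (hc : c ∈ M)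
    (hg : IsBoundedDensity g B R)
    (hinv : ∀ ζ, ζ ≠ 0 → g ζ * ζ = g (f c ζ) * conj ζ) (hv : cauchyTransform g c = 0)
    {z : ℂ} (hz : z ∉ interior (K c)) : cauchyTransform g z = 0 := by
  have h1 : IsClosed {z | cauchyTransform g z = 0} :=
    isClosed_eq hg.continuous_cauchyTransform continuous_const
  have h2 : (K c)ᶜ ⊆ {z | cauchyTransform g z = 0} := fun z hz =>
    cauchyTransform_eq_zero_of_notMem_K hc hg hinv hv hz
  refine closure_minimal h2 h1 ?_
  rwa [closure_compl]

theorem eq_zero_of_eq_zero_on_frontier {v : ℂ → ℂ} {V : Set ℂ} {z₁ : ℂ} {r : ℝ} (hr : 0 < r)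
    (hV : IsOpen V) (hVb : Bornology.IsBounded V) (hvc : Continuous v)
    (hvd : DifferentiableOn ℂ v (V \ closedBall z₁ r)) (hv : ∀ z ∈ closure V, z ∉ V → v z = 0)
    {z : ℂ} (hz : z ∈ V \ closedBall z₁ r) : v z = 0 := by
  have hU : IsOpen (V \ closedBall z₁ r) := hV.sdiff isClosed_closedBall
  obtain ⟨C, hC⟩ := (isCompact_closedBall z₁ r).exists_bound_of_continuousOn hvc.continuousOn
  have hρ : r < ‖z - z₁‖ := by simpa [dist_eq_norm] using hz.2
  have hC0 : 0 ≤ C := (norm_nonneg _).trans (hC z₁ (mem_closedBall_self hr.le))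
  have key : ∀ m : ℕ, ‖v z * (z - z₁) ^ m‖ ≤ C * r ^ m := by
    intro m
    refine Complex.norm_le_of_forall_mem_frontier_norm_le (f := fun z => v z * (z - z₁) ^ m)
      (hVb.subset Set.sdiff_subset) ⟨hvd.mul (by fun_prop), by fun_prop⟩ ?_ (subset_closure hz)
    intro p hp
    rw [hU.frontier_eq] at hp
    by_cases hpV : p ∈ V
    · have hp1 : p ∈ closedBall z₁ r := by
        by_contra h
        exact hp.2 ⟨hpV, h⟩
      rw [norm_mul, norm_pow]
      have : ‖p - z₁‖ ≤ r := by simpa [dist_eq_norm] using hp1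
      gcongr
      exact hC p hp1
    · rw [hv p (closure_mono Set.sdiff_subset hp.1) hpV, zero_mul, norm_zero]
      positivity
  have hlim : Tendsto (fun m : ℕ => C * (r / ‖z - z₁‖) ^ m) atTop (𝓝 0) := by
    have hlt : r / ‖z - z₁‖ < 1 := (div_lt_one (hr.trans hρ)).2 hρ
    simpa using (tendsto_pow_atTop_nhds_zero_of_lt_one
      (div_nonneg hr.le (norm_nonneg _)) hlt).const_mul C
  have hle : ‖v z‖ ≤ 0 := by
    refine ge_of_tendsto' hlim fun m => ?_
    have := key m
    rw [norm_mul, norm_pow] at this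
    rw [div_pow, ← mul_div_assoc, le_div_iff₀ (pow_pos (hr.trans hρ) m)]
    exact this
  simpa using hle

theorem cauchyTransform_indicator_eq_zero {g : ℂ → ℂ} {B R : ℝ} (hg : IsBoundedDensity g B R)
    {V : Set ℂ} (hV : IsOpen V) {z₁ : ℂ} {r : ℝ} (hW : closedBall z₁ r ⊆ V)
    (hg0 : ∀ ζ ∈ V, ζ ∉ ball z₁ r → g ζ = 0)
    (hv : ∀ z ∈ V \ closedBall z₁ r, cauchyTransform g z = 0) {z : ℂ} (hz : z ∉ closedBall z₁ r) :
    cauchyTransform ((ball z₁ r).indicator g) z = 0 := by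
  classical
  have hms : MeasurableSet (ball z₁ r) := measurableSet_ball
  have hg1 := hg.indicator hms
  have hg2 := hg.indicator hms.compl
  set v₁ := cauchyTransform ((ball z₁ r).indicator g) with hv₁
  set v₂ := cauchyTransform ((ball z₁ r)ᶜ.indicator g) with hv₂
  have hadd : ∀ z, cauchyTransform g z = v₁ z + v₂ z := by
    intro z
    rw [hv₁, hv₂, cauchyTransform, cauchyTransform, cauchyTransform, ← MeasureTheory.integral_add
      (hg1.integrable_mul_inv_sub z) (hg2.integrable_mul_inv_sub z)]
    congr 1
    ext ζ
    rw [← add_mul, ← Pi.add_apply, Set.indicator_self_add_compl]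
  have hd1 : DifferentiableOn ℂ v₁ (closedBall z₁ r)ᶜ :=
    hg1.differentiableOn_cauchyTransform isClosed_closedBall.isOpen_compl fun ζ hζ =>
      Set.indicator_of_notMem (fun h => hζ (ball_subset_closedBall h)) _
  have hd2 : DifferentiableOn ℂ v₂ V := by
    refine hg2.differentiableOn_cauchyTransform hV fun ζ hζ => ?_
    by_cases h : ζ ∈ ball z₁ r
    · exact Set.indicator_of_notMem (by simpa using h) _
    · rw [Set.indicator_of_mem h, hg0 ζ hζ h]
  set E : ℂ → ℂ := fun z => if z ∈ V then - v₂ z else v₁ z with hE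
  have hE1 : ∀ z ∉ closedBall z₁ r, E z = v₁ z := by
    intro z hz
    by_cases h : z ∈ V
    · have := hadd z
      rw [hv z ⟨h, hz⟩] at this
      simp only [hE, if_pos h]
      linear_combination this
    · simp only [hE, if_neg h]
  have hEd : Differentiable ℂ E := by
    intro z
    by_cases h : z ∈ V
    · refine ((hd2.differentiableAt (hV.mem_nhds h)).neg).congr_of_eventuallyEq ?_
      filter_upwards [hV.mem_nhds h] with w hw
      simp only [hE, if_pos hw, Pi.neg_apply]
    · have hz : (closedBall z₁ r)ᶜ ∈ 𝓝 z :=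
        isClosed_closedBall.isOpen_compl.mem_nhds fun h' => h (hW h')
      refine (hd1.differentiableAt hz).congr_of_eventuallyEq ?_
      filter_upwards [hz] with w hw
      exact hE1 w hw
  have hlim : Tendsto E (cocompact ℂ) (𝓝 0) := by
    refine hg1.tendsto_cauchyTransform_cocompact.congr' ?_
    filter_upwards [(isCompact_closedBall z₁ r).compl_mem_cocompact] with w hw
    exact (hE1 w hw).symm
  rw [← hE1 z hz]
  exact hEd.apply_eq_of_tendsto_cocompact z hlim

theorem IsBoundedDensity.mul_of_bounded {g h : ℂ → ℂ} {B R C : ℝ} (hg : IsBoundedDensity g B R)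
    (hh : Continuous h) (hC : ∀ ζ, ‖ζ‖ ≤ R → ‖h ζ‖ ≤ C) (hC0 : 0 ≤ C) :
    IsBoundedDensity (fun ζ => g ζ * h ζ) (B * C) R where
  aestronglyMeasurable := hg.aestronglyMeasurable.mul hh.aestronglyMeasurable
  norm_le ζ := by
    have hB : 0 ≤ B := (norm_nonneg _).trans (hg.norm_le 0)
    by_cases hζ : R < ‖ζ‖
    · rw [hg.eq_zero ζ hζ, zero_mul, norm_zero]
      positivity
    · rw [norm_mul]
      exact mul_le_mul (hg.norm_le ζ) (hC ζ (not_lt.1 hζ)) (norm_nonneg _) hB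
  eq_zero ζ hζ := by rw [hg.eq_zero ζ hζ, zero_mul]

theorem integral_eq_zero_of_cauchyTransform_eq_zero {g : ℂ → ℂ} {B R : ℝ}
    (hg : IsBoundedDensity g B R) (h : ∀ᶠ z in cocompact ℂ, cauchyTransform g z = 0) :
    ∫ ζ, g ζ = 0 ∧ ∀ᶠ z in cocompact ℂ, cauchyTransform (fun ζ => g ζ * ζ) z = 0 := by
  have hg1 : IsBoundedDensity (fun ζ => g ζ * ζ) (B * |R|) R :=
    hg.mul_of_bounded continuous_id (fun ζ hζ => hζ.trans (le_abs_self R)) (abs_nonneg R)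
  have key : ∀ z, cauchyTransform (fun ζ => g ζ * ζ) z = (∫ ζ, g ζ) + z * cauchyTransform g z := by
    intro z
    rw [cauchyTransform, cauchyTransform, ← MeasureTheory.integral_const_mul,
      ← MeasureTheory.integral_add hg.integrable ((hg.integrable_mul_inv_sub z).const_mul z)]
    refine MeasureTheory.integral_congr_ae ?_
    have : ∀ᵐ w : ℂ, w ≠ z := by
      rw [MeasureTheory.ae_iff]
      simp
    filter_upwards [this] with w hw
    have : w - z ≠ 0 := sub_ne_zero.2 hw
    field_simp
    ring
  have h1 : (fun z => cauchyTransform (fun ζ => g ζ * ζ) z) =ᶠ[cocompact ℂ] fun _ => ∫ ζ, g ζ := by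
    filter_upwards [h] with z hz
    rw [key, hz, mul_zero, add_zero]
  have h2 : ∫ ζ, g ζ = 0 :=
    tendsto_nhds_unique tendsto_const_nhds
      ((tendsto_congr' h1).1 hg1.tendsto_cauchyTransform_cocompact)
  refine ⟨h2, ?_⟩
  filter_upwards [h1] with z hz
  rw [hz, h2]

open ComplexConjugate in
theorem coeff_eq_zero_of_cauchyTransform_eq_zero {g : ℂ → ℂ} {B R : ℝ}
    (hg : IsBoundedDensity g B R) {z₁ : ℂ} {r : ℝ} (hr : 0 < r) {a b : ℂ}
    (hab : ∀ ζ ∈ ball z₁ r, g ζ = a + b * conj ζ) (h0 : ∀ ζ ∉ ball z₁ r, g ζ = 0)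
    (h : ∀ᶠ z in cocompact ℂ, cauchyTransform g z = 0) : a = 0 ∧ b = 0 := by
  have hms : MeasurableSet (ball z₁ r) := measurableSet_ball
  have hg1 : IsBoundedDensity (fun ζ => g ζ * ζ) (B * |R|) R :=
    hg.mul_of_bounded continuous_id (fun ζ hζ => hζ.trans (le_abs_self R)) (abs_nonneg R)
  obtain ⟨e0, h1⟩ := integral_eq_zero_of_cauchyTransform_eq_zero hg h
  obtain ⟨e1, -⟩ := integral_eq_zero_of_cauchyTransform_eq_zero hg1 h1
  have hsq : ∀ ζ, ((‖g ζ‖ ^ 2 : ℝ) : ℂ) = conj a * g ζ + conj b * (g ζ * ζ) := by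
    intro ζ
    rw [Complex.ofReal_pow, ← Complex.mul_conj']
    by_cases hζ : ζ ∈ ball z₁ r
    · rw [hab ζ hζ]
      simp only [map_add, map_mul, Complex.conj_conj]
      ring
    · rw [h0 ζ hζ]
      simp
  have hInt : ∫ ζ, ((‖g ζ‖ ^ 2 : ℝ) : ℂ) = 0 := by
    simp_rw [hsq]
    rw [MeasureTheory.integral_add (hg.integrable.const_mul _) (hg1.integrable.const_mul _),
      MeasureTheory.integral_const_mul, MeasureTheory.integral_const_mul, e0, e1]
    simp
  have hi2 : MeasureTheory.Integrable fun ζ => ‖g ζ‖ ^ 2 := by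
    have : MeasureTheory.Integrable fun ζ => ((‖g ζ‖ ^ 2 : ℝ) : ℂ) := by
      simp_rw [hsq]
      exact (hg.integrable.const_mul _).add (hg1.integrable.const_mul _)
    exact this.re
  rw [integral_complex_ofReal, Complex.ofReal_eq_zero,
    MeasureTheory.integral_eq_zero_iff_of_nonneg (fun ζ => by positivity) hi2] at hInt
  have hae : (fun ζ => a + b * conj ζ) =ᵐ[MeasureTheory.volume.restrict (ball z₁ r)]
      fun _ => (0 : ℂ) := by
    filter_upwards [MeasureTheory.ae_restrict_of_ae hInt, MeasureTheory.ae_restrict_mem hms]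
      with ζ h1 h2
    rw [← hab ζ h2]
    simpa using h1
  have heq := MeasureTheory.Measure.eqOn_open_of_ae_eq hae isOpen_ball
    (by fun_prop) continuousOn_const
  have p1 := heq (mem_ball_self hr)
  have p2 := heq (x := z₁ + (r / 2 : ℝ)) (by
    rw [mem_ball, dist_eq_norm, add_sub_cancel_left, Complex.norm_real, Real.norm_eq_abs,
      abs_of_pos (by positivity)]
    linarith)
  simp only [map_add, Complex.conj_ofReal] at p1 p2
  have hb : b * ((r / 2 : ℝ) : ℂ) = 0 := by linear_combination p2 - p1
  have hb' : b = 0 := by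
    rcases mul_eq_zero.1 hb with h | h
    · exact h
    · rw [Complex.ofReal_eq_zero] at h
      linarith
  rw [hb', zero_mul, add_zero] at p1
  exact ⟨p1, hb'⟩

open ComplexConjugate in
theorem false_of_invariant_densities {c : ℂ} (hc : c ∈ M) {V : Set ℂ} (hV : IsOpen V)
    (hVK : V ⊆ K c) (hVb : ∀ z ∈ closure V, z ∉ V → z ∉ interior (K c)) {z₁ : ℂ} {r : ℝ}
    (hr : 0 < r) (hW : closedBall z₁ r ⊆ V) {σ τ : ℂ → ℂ} {B C R : ℝ}
    (hσ : IsBoundedDensity σ B R) (hτ : IsBoundedDensity τ C R)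
    (hσi : ∀ ζ, ζ ≠ 0 → σ ζ * ζ = σ (f c ζ) * conj ζ)
    (hτi : ∀ ζ, ζ ≠ 0 → τ ζ * ζ = τ (f c ζ) * conj ζ)
    (hσ1 : ∀ ζ ∈ ball z₁ r, σ ζ = 1) (hτ1 : ∀ ζ ∈ ball z₁ r, τ ζ = conj ζ)
    (hσ0 : ∀ ζ ∈ V, ζ ∉ ball z₁ r → σ ζ = 0) (hτ0 : ∀ ζ ∈ V, ζ ∉ ball z₁ r → τ ζ = 0) :
    False := by
  obtain ⟨a, b, hab, hv⟩ : ∃ a b : ℂ, ¬ (a = 0 ∧ b = 0) ∧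
      a * cauchyTransform σ c + b * cauchyTransform τ c = 0 := by
    by_cases h : cauchyTransform σ c = 0
    · exact ⟨1, 0, by simp, by simp [h]⟩
    · exact ⟨- cauchyTransform τ c, cauchyTransform σ c, fun h' => h h'.2, by ring⟩
  set g : ℂ → ℂ := fun ζ => a * σ ζ + b * τ ζ with hgdef
  have hg : IsBoundedDensity g (‖a‖ * B + ‖b‖ * C) R := by
    refine ⟨(hσ.aestronglyMeasurable.const_mul a).add (hτ.aestronglyMeasurable.const_mul b),
      fun ζ => ?_, fun ζ hζ => ?_⟩
    · refine (norm_add_le _ _).trans ?_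
      rw [norm_mul, norm_mul]
      exact add_le_add (mul_le_mul_of_nonneg_left (hσ.norm_le ζ) (norm_nonneg _))
        (mul_le_mul_of_nonneg_left (hτ.norm_le ζ) (norm_nonneg _))
    · simp [hgdef, hσ.eq_zero ζ hζ, hτ.eq_zero ζ hζ]
  have hgi : ∀ ζ, ζ ≠ 0 → g ζ * ζ = g (f c ζ) * conj ζ := by
    intro ζ hζ
    simp only [hgdef]
    linear_combination a * hσi ζ hζ + b * hτi ζ hζ
  have hgc : cauchyTransform g c = 0 := by
    rw [← hv, cauchyTransform, cauchyTransform, cauchyTransform,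
      ← MeasureTheory.integral_const_mul, ← MeasureTheory.integral_const_mul,
      ← MeasureTheory.integral_add ((hσ.integrable_mul_inv_sub c).const_mul a)
      ((hτ.integrable_mul_inv_sub c).const_mul b)]
    congr 1
    ext ζ
    simp only [hgdef]
    ring
  have hg0 : ∀ ζ ∈ V, ζ ∉ ball z₁ r → g ζ = 0 := by
    intro ζ h1 h2
    simp [hgdef, hσ0 ζ h1 h2, hτ0 ζ h1 h2]
  have hvan : ∀ z ∈ V \ closedBall z₁ r, cauchyTransform g z = 0 := by
    intro z hz
    refine eq_zero_of_eq_zero_on_frontier hr hV ((isBounded_K c).subset hVK)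
      hg.continuous_cauchyTransform ?_ ?_ hz
    · exact hg.differentiableOn_cauchyTransform (hV.sdiff isClosed_closedBall) fun ζ hζ =>
        hg0 ζ hζ.1 fun h => hζ.2 (ball_subset_closedBall h)
    · intro z h1 h2
      exact cauchyTransform_eq_zero_of_notMem_interior_K hc hg hgi hgc (hVb z h1 h2)
  refine hab (coeff_eq_zero_of_cauchyTransform_eq_zero
    (hg.indicator (measurableSet_ball : MeasurableSet (ball z₁ r))) hr (fun ζ hζ => ?_)
    (fun ζ hζ => Set.indicator_of_notMem hζ _) ?_)
  · rw [Set.indicator_of_mem hζ]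
    simp only [hgdef, hσ1 ζ hζ, hτ1 ζ hζ, mul_one]
  · filter_upwards [(isCompact_closedBall z₁ r).compl_mem_cocompact] with z hz
    exact cauchyTransform_indicator_eq_zero hg hV hW hg0 hvan hz

/-- The derivative of the `n`-th iterate of `f c`, up to a power of two. -/
def orbitProd (c : ℂ) (n : ℕ) (z : ℂ) : ℂ :=
  ∏ k ∈ Finset.range n, (f c)^[k] z

theorem orbitProd_add (c : ℂ) (m n : ℕ) (z : ℂ) :
    orbitProd c (m + n) z = orbitProd c m z * orbitProd c n ((f c)^[m] z) := by
  rw [orbitProd, orbitProd, orbitProd, Finset.prod_range_add]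
  congr 1
  refine Finset.prod_congr rfl fun k _ => ?_
  rw [add_comm, Function.iterate_add_apply]

theorem orbitProd_one_add (c : ℂ) (n : ℕ) (z : ℂ) :
    orbitProd c (n + 1) z = z * orbitProd c n (f c z) := by
  rw [add_comm, orbitProd_add]
  simp [orbitProd]

theorem continuous_orbitProd (c : ℂ) (n : ℕ) : Continuous (orbitProd c n) :=
  continuous_finsetProd _ fun k _ => continuous_iterate_f c k

/-- No two points of the grand orbits through `V` collide, and `V` avoids preimages of `0`. -/
structure IsWandering (c : ℂ) (V : Set ℂ) : Prop where
  iterate_ne_zero : ∀ w ∈ V, ∀ n, (f c)^[n] w ≠ 0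
  eq_of_iterate_eq : ∀ w ∈ V, ∀ w' ∈ V, ∀ i j, (f c)^[i] w = (f c)^[j] w' → i = j ∧ w = w'

theorem IsWandering.orbitProd_ne_zero {c : ℂ} {V : Set ℂ} (hV : IsWandering c V) {w : ℂ}
    (hw : w ∈ V) (n : ℕ) : orbitProd c n w ≠ 0 :=
  Finset.prod_ne_zero_iff.2 fun k _ => hV.iterate_ne_zero w hw k

theorem IsWandering.orbitProd_iterate_ne_zero {c : ℂ} {V : Set ℂ} (hV : IsWandering c V) {w : ℂ}
    (hw : w ∈ V) (n j : ℕ) : orbitProd c n ((f c)^[j] w) ≠ 0 := by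
  have := hV.orbitProd_ne_zero hw (j + n)
  rw [orbitProd_add] at this
  exact right_ne_zero_of_mul this

/-- The point `y` is matched with `w ∈ W` by a noncritical holomorphic correspondence
`f^i y = f^j w`. -/
def Matched (c : ℂ) (W : Set ℂ) (y : ℂ) (i j : ℕ) (w : ℂ) : Prop :=
  w ∈ W ∧ (f c)^[i] y = (f c)^[j] w ∧ orbitProd c i y ≠ 0

open ComplexConjugate in
/-- The unimodular factor `u / conj u` for `u = (f^n)' z`. -/
def twist (c : ℂ) (n : ℕ) (z : ℂ) : ℂ := orbitProd c n z / conj (orbitProd c n z)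

theorem twist_add (c : ℂ) (m n : ℕ) (z : ℂ) :
    twist c (m + n) z = twist c m z * twist c n ((f c)^[m] z) := by
  rw [twist, twist, twist, orbitProd_add, map_mul, mul_div_mul_comm]

theorem twist_ne_zero {c : ℂ} {n : ℕ} {z : ℂ} (h : orbitProd c n z ≠ 0) : twist c n z ≠ 0 :=
  div_ne_zero h ((map_ne_zero _).2 h)

theorem norm_twist {c : ℂ} {n : ℕ} {z : ℂ} (h : orbitProd c n z ≠ 0) : ‖twist c n z‖ = 1 := by
  rw [twist, norm_div, RCLike.norm_conj, div_self (norm_ne_zero_iff.2 h)]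

theorem continuousAt_twist {c : ℂ} {n : ℕ} {z : ℂ} (h : orbitProd c n z ≠ 0) :
    ContinuousAt (twist c n) z :=
  (continuous_orbitProd c n).continuousAt.div
    (Complex.continuous_conj.comp (continuous_orbitProd c n)).continuousAt ((map_ne_zero _).2 h)

theorem Matched.unique {c : ℂ} {V W : Set ℂ} (hV : IsWandering c V) (hW : W ⊆ V) {y w w' : ℂ}
    {i j i' j' : ℕ} (h : Matched c W y i j w) (h' : Matched c W y i' j' w') :
    w = w' ∧ twist c j w / twist c i y = twist c j' w' / twist c i' y := by
  obtain ⟨hw, he, hd⟩ := h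
  obtain ⟨hw', he', hd'⟩ := h'
  have key : (f c)^[j + i'] w = (f c)^[j' + i] w' := by
    rw [add_comm j, Function.iterate_add_apply, ← he, add_comm j', Function.iterate_add_apply,
      ← he', ← Function.iterate_add_apply, ← Function.iterate_add_apply, add_comm]
  obtain ⟨hij, rfl⟩ := hV.eq_of_iterate_eq w (hW hw) w' (hW hw') _ _ key
  refine ⟨rfl, ?_⟩
  have e1 : twist c j w / twist c i y = twist c (j + i') w / twist c (i + i') y := by
    rw [twist_add, twist_add, he, mul_div_mul_right]
    exact twist_ne_zero (hV.orbitProd_iterate_ne_zero (hW hw) _ _)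
  have e2 : twist c j' w / twist c i' y = twist c (j' + i) w / twist c (i' + i) y := by
    rw [twist_add, twist_add, he', mul_div_mul_right]
    exact twist_ne_zero (hV.orbitProd_iterate_ne_zero (hW hw) _ _)
  rw [e1, e2, hij, add_comm i]

open Classical in
/-- Extension of the density `ν` on `W` to an `f`-invariant density on the grand orbit of `W`. -/
def spread (c : ℂ) (W : Set ℂ) (ν : ℂ → ℂ) (y : ℂ) : ℂ :=
  if h : ∃ t : ℕ × ℕ × ℂ, Matched c W y t.1 t.2.1 t.2.2 then
    ν h.choose.2.2 * (twist c h.choose.2.1 h.choose.2.2 / twist c h.choose.1 y)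
  else 0

section Spread

variable {c : ℂ} {V W : Set ℂ}

theorem Matched.spread_eq (hV : IsWandering c V) (hW : W ⊆ V) (ν : ℂ → ℂ) {y w : ℂ} {i j : ℕ}
    (h : Matched c W y i j w) : spread c W ν y = ν w * (twist c j w / twist c i y) := by
  have hex : ∃ t : ℕ × ℕ × ℂ, Matched c W y t.1 t.2.1 t.2.2 := ⟨(i, j, w), h⟩
  rw [spread, dif_pos hex]
  obtain ⟨h1, h2⟩ := hex.choose_spec.unique hV hW h
  rw [h2, h1]

theorem spread_eq_zero {ν : ℂ → ℂ} {y : ℂ} (h : ¬ ∃ i j w, Matched c W y i j w) :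
    spread c W ν y = 0 := by
  rw [spread, dif_neg]
  rintro ⟨t, ht⟩
  exact h ⟨_, _, _, ht⟩

open ComplexConjugate in
theorem spread_mul (hV : IsWandering c V) (hW : W ⊆ V) (ν : ℂ → ℂ) {ζ : ℂ} (hζ : ζ ≠ 0) :
    spread c W ν ζ * ζ = spread c W ν (f c ζ) * conj ζ := by
  have hζ' : conj ζ ≠ 0 := (map_ne_zero _).2 hζ
  by_cases h : ∃ i j w, Matched c W (f c ζ) i j w
  · obtain ⟨i, j, w, hm⟩ := h
    have hm' : Matched c W ζ (i + 1) j w :=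
      ⟨hm.1, hm.2.1, by rw [orbitProd_one_add]; exact mul_ne_zero hζ hm.2.2⟩
    have ht : twist c (i + 1) ζ = ζ / conj ζ * twist c i (f c ζ) := by
      rw [twist, twist, orbitProd_one_add, map_mul, mul_div_mul_comm]
    have ht0 := twist_ne_zero hm.2.2
    rw [hm.spread_eq hV hW, hm'.spread_eq hV hW, ht]
    field_simp
  · have h' : ¬ ∃ i j w, Matched c W ζ i j w := by
      rintro ⟨i, j, w, hw, he, hd⟩
      refine h ⟨i, j + 1, w, hw, ?_, ?_⟩
      · rw [← Function.iterate_succ_apply, Function.iterate_succ_apply', he,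
          Function.iterate_succ_apply']
      · have h1 : orbitProd c (i + 1) ζ ≠ 0 := by
          rw [orbitProd_add, he]
          exact mul_ne_zero hd (hV.orbitProd_iterate_ne_zero (hW hw) _ _)
        rw [orbitProd_one_add] at h1
        exact right_ne_zero_of_mul h1
    rw [spread_eq_zero h, spread_eq_zero h', zero_mul, zero_mul]

theorem spread_eq_of_mem (hV : IsWandering c V) (hW : W ⊆ V) (ν : ℂ → ℂ) {w : ℂ} (hw : w ∈ W) :
    spread c W ν w = ν w := by
  have hm : Matched c W w 0 0 w := ⟨hw, rfl, by simp [orbitProd]⟩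
  rw [hm.spread_eq hV hW]
  simp [twist, orbitProd]

theorem spread_eq_zero_of_notMem (hV : IsWandering c V) (hW : W ⊆ V) (ν : ℂ → ℂ) {y : ℂ}
    (hy : y ∈ V) (hyW : y ∉ W) : spread c W ν y = 0 := by
  refine spread_eq_zero ?_
  rintro ⟨i, j, w, hw, he, -⟩
  obtain ⟨-, rfl⟩ := hV.eq_of_iterate_eq y hy w (hW hw) i j he
  exact hyW hw

theorem Matched.eventually (hWo : IsOpen W) {y w : ℂ} {i j : ℕ} (h : Matched c W y i j w) :
    ∀ᶠ y' in 𝓝 y, ∃ w', Matched c W y' i j w' := by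
  have h1 : (f c)^[j] '' W ∈ 𝓝 ((f c)^[i] y) := by
    refine (isOpenMap_iterate_f c j W hWo).mem_nhds ?_
    exact ⟨w, h.1, h.2.1.symm⟩
  filter_upwards [(continuous_iterate_f c i).continuousAt.preimage_mem_nhds h1,
    (continuous_orbitProd c i).continuousAt.eventually_ne h.2.2] with y' h2 h3
  obtain ⟨w', hw', he⟩ := h2
  exact ⟨w', hw', he.symm, h3⟩

theorem Matched.continuousAt_spread (hV : IsWandering c V) (hW : W ⊆ V) (hWo : IsOpen W)
    {ν : ℂ → ℂ} (hν : Continuous ν) {y w : ℂ} {i j : ℕ} (h : Matched c W y i j w) :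
    ContinuousAt (spread c W ν) y := by
  have hinj : Set.InjOn (f c)^[j] W := fun a ha b hb hab =>
    (hV.eq_of_iterate_eq a (hW ha) b (hW hb) j j hab).2
  have hleft : ∀ a ∈ W, Function.invFunOn (f c)^[j] W ((f c)^[j] a) = a := fun a ha =>
    hinj.leftInvOn_invFunOn ha
  have hcinv : ContinuousAt (Function.invFunOn (f c)^[j] W) ((f c)^[j] w) := by
    have h1 : Tendsto (Function.invFunOn (f c)^[j] W) (map (f c)^[j] (𝓝 w)) (𝓝 w) := by
      rw [tendsto_map'_iff]
      refine tendsto_id.congr' ?_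
      filter_upwards [hWo.mem_nhds h.1] with a ha
      exact (hleft a ha).symm
    rw [ContinuousAt, hleft w h.1]
    exact h1.mono_left ((isOpenMap_iterate_f c j).nhds_le w)
  have hcomp : ContinuousAt (fun y' => Function.invFunOn (f c)^[j] W ((f c)^[i] y')) y := by
    refine ContinuousAt.comp (g := Function.invFunOn (f c)^[j] W) ?_
      (continuous_iterate_f c i).continuousAt
    rw [h.2.1]
    exact hcinv
  have hval : Function.invFunOn (f c)^[j] W ((f c)^[i] y) = w := by
    rw [h.2.1, hleft w h.1]
  have hc2 : ContinuousAt (fun y' => ν (Function.invFunOn (f c)^[j] W ((f c)^[i] y')) *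
      (twist c j (Function.invFunOn (f c)^[j] W ((f c)^[i] y')) / twist c i y')) y := by
    refine (hν.continuousAt.comp hcomp).mul (ContinuousAt.div ?_ (continuousAt_twist h.2.2)
      (twist_ne_zero h.2.2))
    refine ContinuousAt.comp (g := twist c j) ?_ hcomp
    rw [hval]
    exact continuousAt_twist (hV.orbitProd_ne_zero (hW h.1) j)
  refine hc2.congr ?_
  filter_upwards [h.eventually hWo] with y' hy'
  obtain ⟨w', hm⟩ := hy'
  rw [hm.spread_eq hV hW, hm.2.1, hleft w' hm.1]

theorem isBoundedDensity_spread (hV : IsWandering c V) (hW : W ⊆ V) (hWo : IsOpen W)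
    (hWK : W ⊆ K c) {ν : ℂ → ℂ} (hν : Continuous ν) {B : ℝ} (hB0 : 0 ≤ B)
    (hB : ∀ w ∈ W, ‖ν w‖ ≤ B) : IsBoundedDensity (spread c W ν) B (escapeRadius c) where
  aestronglyMeasurable := by
    have hX : IsOpen {y | ∃ i j w, Matched c W y i j w} := by
      refine isOpen_iff_mem_nhds.2 ?_
      rintro y ⟨i, j, w, h⟩
      filter_upwards [h.eventually hWo] with y' hy'
      exact ⟨i, j, hy'⟩
    have hc : ContinuousOn (spread c W ν) {y | ∃ i j w, Matched c W y i j w} := by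
      rintro y ⟨i, j, w, h⟩
      exact (h.continuousAt_spread hV hW hWo hν).continuousWithinAt
    have he : spread c W ν = {y | ∃ i j w, Matched c W y i j w}.indicator (spread c W ν) := by
      ext y
      by_cases h : ∃ i j w, Matched c W y i j w
      · exact (Set.indicator_of_mem (s := {y | ∃ i j w, Matched c W y i j w}) h _).symm
      · rw [spread_eq_zero h]
        exact (Set.indicator_of_notMem (s := {y | ∃ i j w, Matched c W y i j w}) h _).symm
    rw [he, aestronglyMeasurable_indicator_iff hX.measurableSet]
    exact hc.aestronglyMeasurable hX.measurableSet
  norm_le y := by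
    by_cases h : ∃ i j w, Matched c W y i j w
    · obtain ⟨i, j, w, h⟩ := h
      rw [h.spread_eq hV hW, norm_mul, norm_div, norm_twist h.2.2,
        norm_twist (hV.orbitProd_ne_zero (hW h.1) j), div_one, mul_one]
      exact hB w h.1
    · rw [spread_eq_zero h, norm_zero]
      exact hB0
  eq_zero y hy := by
    refine spread_eq_zero ?_
    rintro ⟨i, j, w, hw, he, -⟩
    have h1 := (iterate_f_mem_K_iff j).2 (hWK hw)
    rw [← he, iterate_f_mem_K_iff] at h1
    exact absurd (norm_le_of_mem_K h1) (not_le.2 hy)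

end Spread

theorem not_isWandering {c : ℂ} (hc : c ∈ M) {V : Set ℂ} (hV : IsOpen V) (hne : V.Nonempty)
    (hVK : V ⊆ K c) (hVb : ∀ z ∈ closure V, z ∉ V → z ∉ interior (K c)) :
    ¬ IsWandering c V := by
  intro hw
  obtain ⟨z₁, hz₁⟩ := hne
  obtain ⟨ε, hε, hball⟩ := Metric.nhds_basis_closedBall.mem_iff.1 (hV.mem_nhds hz₁)
  have hWV : ball z₁ ε ⊆ V := ball_subset_closedBall.trans hball
  have hWK := hWV.trans hVK
  exact false_of_invariant_densities hc hV hVK hVb hε hball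
    (isBoundedDensity_spread hw hWV isOpen_ball hWK (ν := fun _ => 1) continuous_const
      zero_le_one (fun w _ => by simp))
    (isBoundedDensity_spread hw hWV isOpen_ball hWK (ν := starRingEnd ℂ)
      Complex.continuous_conj ((norm_nonneg _).trans (norm_le_escapeRadius c))
      (fun w hw => by
        rw [RCLike.norm_conj]
        exact norm_le_of_mem_K (hWK hw)))
    (fun ζ hζ => spread_mul hw hWV _ hζ) (fun ζ hζ => spread_mul hw hWV _ hζ)
    (fun ζ hζ => spread_eq_of_mem hw hWV _ hζ) (fun ζ hζ => spread_eq_of_mem hw hWV _ hζ)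
    (fun ζ h1 h2 => spread_eq_zero_of_notMem hw hWV _ h1 h2)
    (fun ζ h1 h2 => spread_eq_zero_of_notMem hw hWV _ h1 h2)

theorem injOn_f_interiorComponent {c z : ℂ} (h0 : (0 : ℂ) ∉ interiorComponent c z) :
    Set.InjOn (f c) (interiorComponent c z) := by
  intro x hx y hy hxy
  have h1 : x ^ 2 = y ^ 2 := by simpa [f] using hxy
  rcases sq_eq_sq_iff_eq_or_eq_neg.1 h1 with h2 | h2
  · exact h2
  exfalso
  have hneg : ∀ w ∈ interiorComponent c z, -w ∈ interiorComponent c z := by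
    have hS : IsPreconnected ((fun w => -w) '' interiorComponent c z) :=
      (isPreconnected_interiorComponent c z).image _ continuous_neg.continuousOn
    have hSK : (fun w => -w) '' interiorComponent c z ⊆ interior (K c) := by
      refine interior_maximal ?_ ((Homeomorph.neg ℂ).isOpenMap _ (isOpen_interiorComponent c z))
      rintro _ ⟨w, hw, rfl⟩
      exact neg_mem_K_iff.2 (interiorComponent_subset_K c z hw)
    have hsub := subset_interiorComponent hS ⟨y, hy, h2.symm⟩ hSK
    rw [interiorComponent_eq hx] at hsub
    exact fun w hw => hsub ⟨w, hw, rfl⟩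
  obtain ⟨l, hl, he⟩ := exists_log_on_interiorComponent h0
  have hmaps : Set.MapsTo (fun w : ℂ => -w) (interiorComponent c z) (interiorComponent c z) := hneg
  have hcont : ContinuousOn (fun w => l (-w) - l w) (interiorComponent c z) :=
    (hl.continuousOn.comp continuous_neg.continuousOn hmaps).sub hl.continuousOn
  have hexp : ∀ w ∈ interiorComponent c z, Complex.exp (l (-w) - l w) = -1 := by
    intro w hw
    have hw0 : w ≠ 0 := fun h => h0 (h ▸ hw)
    rw [Complex.exp_sub, he w hw, he _ (hneg w hw), sub_zero, sub_zero, neg_div, div_self hw0]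
  have hconst := eq_of_exp_eq_const (isPreconnected_interiorComponent c z) hcont hexp hy
    (hneg y hy)
  simp only [neg_neg] at hconst
  have hz := hexp y hy
  have : l (-y) - l y = 0 := by linear_combination hconst / 2
  rw [this, Complex.exp_zero] at hz
  norm_num at hz

theorem exists_interiorComponent_iterate_eq {c z : ℂ} (hc : c ∈ M) (hz : z ∈ interior (K c)) :
    ∃ i j, i < j ∧
      interiorComponent c ((f c)^[j] z) = interiorComponent c ((f c)^[i] z) := by
  by_contra! h
  have hne : ∀ i j, interiorComponent c ((f c)^[j] z) = interiorComponent c ((f c)^[i] z) →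
      i = j := by
    intro i j hij
    rcases lt_trichotomy i j with h1 | h1 | h1
    · exact absurd hij (h i j h1)
    · exact h1
    · exact absurd hij.symm (h j i h1)
  have hdisj : ∀ i j x, x ∈ interiorComponent c ((f c)^[i] z) →
      x ∈ interiorComponent c ((f c)^[j] z) → i = j := fun i j x hi hj =>
    hne i j ((interiorComponent_eq hj).symm.trans (interiorComponent_eq hi))
  obtain ⟨N, hN⟩ : ∃ N, ∀ n ≥ N, (0 : ℂ) ∉ interiorComponent c ((f c)^[n] z) := by
    by_cases h0 : ∃ n, (0 : ℂ) ∈ interiorComponent c ((f c)^[n] z)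
    · obtain ⟨n, hn⟩ := h0
      refine ⟨n + 1, fun m hm h' => ?_⟩
      have := hdisj n m 0 hn h'
      omega
    · push Not at h0
      exact ⟨0, fun n _ => h0 n⟩
  have hmem : ∀ w ∈ interiorComponent c ((f c)^[N] z), ∀ n,
      (f c)^[n] w ∈ interiorComponent c ((f c)^[n + N] z) := by
    intro w hw n
    rw [Function.iterate_add_apply]
    exact iterate_f_mem_interiorComponent hw n
  refine not_isWandering hc (isOpen_interiorComponent c ((f c)^[N] z))
    ⟨_, mem_interiorComponent (iterate_f_mem_interior_K hz N)⟩ (interiorComponent_subset_K c _)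
    (fun w hw hw' => notMem_interior_of_mem_closure_interiorComponent hw hw') ⟨?_, ?_⟩
  · intro w hw n hn
    exact hN (n + N) (by omega) (hn ▸ hmem w hw n)
  · intro w hw w' hw' i j hij
    have h1 := hdisj _ _ _ (hmem w hw i) (hij ▸ hmem w' hw' j)
    obtain rfl : i = j := by omega
    refine ⟨rfl, ?_⟩
    clear h1
    induction i with
    | zero => exact hij
    | succ i ih =>
      rw [Function.iterate_succ_apply', Function.iterate_succ_apply'] at hij
      exact ih (injOn_f_interiorComponent (hN (i + N) (by omega)) (hmem w hw i) (hmem w' hw' i) hij)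

theorem escapingAlong_inter_K_eq_empty {U : Filter ℂ} [U.NeBot] {c₀ : ℂ} (hU : U ≤ 𝓝 c₀)
    (hM : c₀ ∈ M) (hP : c₀ ∉ P) : escapingAlong U ∩ K c₀ = ∅ := by
  by_contra hne
  obtain ⟨z, hz⟩ := Set.nonempty_iff_ne_empty.2 hne
  have hInt := escapingAlong_inter_K_subset_interior hU hz
  obtain ⟨i, j, hij, he⟩ := exists_interiorComponent_iterate_eq hM hInt
  refine escapingAlong_periodic_false hU hP (iterate_f_mem_escapingAlong hU hz.1 i)
    (iterate_f_mem_interior_K hInt i) (m := j - i) (by omega) ?_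
  rw [← Function.iterate_add_apply, Nat.sub_add_cancel hij.le]
  exact he

theorem eventually_hausdorffDist_K_lt {c₀ : ℂ} (hM : c₀ ∈ M) (hP : c₀ ∉ P) {ε : ℝ} (hε : 0 < ε) :
    ∀ᶠ c in 𝓝[M \ P] c₀, hausdorffDist (K c) (K c₀) < ε := by
  have hbd : ∀ᶠ c in 𝓝 c₀, escapeRadius c ≤ escapeRadius c₀ + 1 := by
    filter_upwards [ball_mem_nhds c₀ one_pos] with c hc
    have h1 := norm_le_escapeRadius c₀
    have h2 := four_le_escapeRadius c₀
    rw [mem_ball, dist_eq_norm] at hc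
    have h3 := norm_le_norm_add_norm_sub' c c₀
    exact max_le (by linarith) (by linarith)
  have upper : ∀ᶠ c in 𝓝[M \ P] c₀, ∀ x ∈ K c, ∃ y ∈ K c₀, dist x y ≤ ε / 2 := by
    by_contra hfreq
    rw [not_eventually] at hfreq
    have hne := frequently_iff_neBot.1 hfreq
    set F := 𝓝[M \ P] c₀ ⊓ 𝓟 {c | ¬ ∀ x ∈ K c, ∃ y ∈ K c₀, dist x y ≤ ε / 2} with hF
    have hFle : F ≤ 𝓝 c₀ := inf_le_left.trans nhdsWithin_le_nhds
    have hex : ∀ c, ∃ x, (¬ ∀ x ∈ K c, ∃ y ∈ K c₀, dist x y ≤ ε / 2) →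
        x ∈ K c ∧ ∀ y ∈ K c₀, ε / 2 < dist x y := by
      intro c
      by_cases h : ∀ x ∈ K c, ∃ y ∈ K c₀, dist x y ≤ ε / 2
      · exact ⟨0, fun h' => absurd h h'⟩
      · have h' := h
        push Not at h'
        obtain ⟨x, hx⟩ := h'
        exact ⟨x, fun _ => hx⟩
    choose x hx using hex
    have hFx : ∀ᶠ c in F, x c ∈ K c ∧ ∀ y ∈ K c₀, ε / 2 < dist (x c) y := by
      have : {c | ¬ ∀ x ∈ K c, ∃ y ∈ K c₀, dist x y ≤ ε / 2} ∈ F := mem_inf_of_right (mem_principal_self _)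
      filter_upwards [this] with c hc
      exact hx c hc
    set U := Ultrafilter.of F with hUdef
    have hUF : (U : Filter ℂ) ≤ F := Ultrafilter.of_le F
    have hcomp : closedBall (0 : ℂ) (escapeRadius c₀ + 1) ∈ U.map x := by
      rw [Ultrafilter.mem_map]
      have : ∀ᶠ c in (U : Filter ℂ), x c ∈ closedBall (0 : ℂ) (escapeRadius c₀ + 1) := by
        filter_upwards [hUF hFx, (hUF.trans hFle) hbd] with c h1 h2
        rw [mem_closedBall_zero_iff]
        exact (norm_le_of_mem_K h1.1).trans h2
      exact this
    obtain ⟨p, -, hp⟩ := (isCompact_closedBall (0 : ℂ) (escapeRadius c₀ + 1)).ultrafilter_le_nhds'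
      (U.map x) hcomp
    have hp' : Tendsto x U (𝓝 p) := hp
    have hpK : p ∈ K c₀ := by
      rw [mem_K_iff]
      by_contra! hcon
      obtain ⟨n, hn⟩ := hcon
      have ht : Tendsto (fun c => (f c)^[n] (x c)) U (𝓝 ((f c₀)^[n] p)) :=
        (continuous_iterate_f_uncurry n).tendsto (c₀, p) |>.comp
          ((tendsto_id.mono_left (hUF.trans hFle)).prodMk_nhds hp')
      have hlt : ∀ᶠ c in (U : Filter ℂ), escapeRadius c < ‖(f c)^[n] (x c)‖ := by
        have hcont : Tendsto escapeRadius U (𝓝 (escapeRadius c₀)) := by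
          have : Continuous escapeRadius := continuous_const.max continuous_norm
          exact (this.tendsto c₀).mono_left (hUF.trans hFle)
        exact hcont.eventually_lt ht.norm hn
      obtain ⟨c, h1, h2⟩ := (hlt.and (hUF hFx)).exists
      exact absurd (mem_K_iff.1 h2.1 n) (not_le.2 h1)
    have hd : Tendsto (fun c => dist (x c) p) U (𝓝 0) := by
      simpa using hp'.dist (tendsto_const_nhds (x := p))
    obtain ⟨c, h1, h2⟩ := ((hd.eventually_lt_const (half_pos hε)).and (hUF hFx)).exists
    exact absurd (h2.2 p hpK) (not_lt.2 h1.le)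
  have lower : ∀ᶠ c in 𝓝[M \ P] c₀, ∀ x ∈ K c₀, ∃ y ∈ K c, dist x y ≤ ε / 2 := by
    by_contra hfreq
    rw [not_eventually] at hfreq
    have hne := frequently_iff_neBot.1 hfreq
    set F := 𝓝[M \ P] c₀ ⊓ 𝓟 {c | ¬ ∀ x ∈ K c₀, ∃ y ∈ K c, dist x y ≤ ε / 2} with hF
    have hFle : F ≤ 𝓝 c₀ := inf_le_left.trans nhdsWithin_le_nhds
    have hex : ∀ c, ∃ x, (¬ ∀ x ∈ K c₀, ∃ y ∈ K c, dist x y ≤ ε / 2) →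
        x ∈ K c₀ ∧ ∀ y ∈ K c, ε / 2 < dist x y := by
      intro c
      by_cases h : ∀ x ∈ K c₀, ∃ y ∈ K c, dist x y ≤ ε / 2
      · exact ⟨0, fun h' => absurd h h'⟩
      · have h' := h
        push Not at h'
        obtain ⟨x, hx⟩ := h'
        exact ⟨x, fun _ => hx⟩
    choose x hx using hex
    have hFx : ∀ᶠ c in F, x c ∈ K c₀ ∧ ∀ y ∈ K c, ε / 2 < dist (x c) y := by
      have : {c | ¬ ∀ x ∈ K c₀, ∃ y ∈ K c, dist x y ≤ ε / 2} ∈ F := mem_inf_of_right (mem_principal_self _)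
      filter_upwards [this] with c hc
      exact hx c hc
    set U := Ultrafilter.of F with hUdef
    have hUF : (U : Filter ℂ) ≤ F := Ultrafilter.of_le F
    have hcomp : K c₀ ∈ U.map x := by
      rw [Ultrafilter.mem_map]
      have : ∀ᶠ c in (U : Filter ℂ), x c ∈ K c₀ := by
        filter_upwards [hUF hFx] with c h1
        exact h1.1
      exact this
    obtain ⟨p, hpK, hp⟩ := (isCompact_K c₀).ultrafilter_le_nhds' (U.map x) hcomp
    have hp' : Tendsto x U (𝓝 p) := hp
    have hd : Tendsto (fun c => dist (x c) p) U (𝓝 0) := by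
      simpa using hp'.dist (tendsto_const_nhds (x := p))
    have hpe : p ∈ escapingAlong (U : Filter ℂ) := by
      refine ⟨ε / 4, by positivity, ?_⟩
      filter_upwards [hd.eventually_lt_const (show 0 < ε / 4 by positivity), hUF hFx] with c h1 h2
      refine Set.disjoint_left.2 fun y hy hyK => ?_
      have h3 := h2.2 y hyK
      have h4 := dist_triangle (x c) p y
      rw [mem_ball, dist_comm] at hy
      linarith
    have := escapingAlong_inter_K_eq_empty (hUF.trans hFle) hM hP
    exact absurd (this ▸ (⟨hpe, hpK⟩ : p ∈ escapingAlong (U : Filter ℂ) ∩ K c₀))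
      (Set.notMem_empty p)
  filter_upwards [upper, lower] with c h1 h2
  exact (hausdorffDist_le_of_mem_dist (half_pos hε).le h1 h2).trans_lt (half_lt_self hε)

/-- For `c ∈ M` the filled Julia set `K_c` is a nonempty compact set, and the map
`c ↦ K_c` is continuous (in the Hausdorff metric) at every point of `M ∖ P`. -/
theorem filledJulia_continuousOn_M_diff_P :
    (∀ c ∈ M, (K c).Nonempty ∧ IsCompact (K c)) ∧
    ∀ c ∈ M \ P, ∀ ε > 0, ∃ δ > 0, ∀ c' ∈ M \ P,
      dist c' c < δ → Metric.hausdorffDist (K c') (K c) < ε := by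
  refine ⟨fun c hc => ⟨⟨0, zero_mem_K hc⟩, isCompact_K c⟩, fun c hc ε hε => ?_⟩
  obtain ⟨δ, hδ, h⟩ := Metric.mem_nhdsWithin_iff.1 (eventually_hausdorffDist_K_lt hc.1 hc.2 hε)
  exact ⟨δ, hδ, fun c' hc' hd => h ⟨hd, hc'⟩⟩
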